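/- Let H = ℤ_2³ × ℤ_5 and let φ be a permutation of H. Then there exists δ ∈ ⟨H_L, φ⁻¹H_Lφ⟩ such that the group ⟨H_L, δ⁻¹φ⁻¹H_Lφδ⟩ admits a complete block system all of whose blocks have size 5. -/

import Mathlib

/-- The left regular representation of `G` as a subgroup of `Sym(G)`. -/
def leftRegular (G : Type*) [Group G] : Subgroup (Equiv.Perm G) :=
  (MulAction.toPermHom G G).range

/-- The conjugate subgroup `φ⁻¹ K φ`. -/
def conjBy {Ω : Type*} (φ : Equiv.Perm Ω) (K : Subgroup (Equiv.Perm Ω)) :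
    Subgroup (Equiv.Perm Ω) :=
  K.map (MulAut.conj φ⁻¹).toMonoidHom

/-- `𝒞` is a complete block system for the permutation group `K`. -/
def IsCompleteBlockSystem {Ω : Type*} [DecidableEq Ω]
    (K : Subgroup (Equiv.Perm Ω)) (𝒞 : Finset (Finset Ω)) : Prop :=
  (∀ x : Ω, ∃! B, B ∈ 𝒞 ∧ x ∈ B) ∧
  ∀ B ∈ 𝒞, ∀ g ∈ K, B.image (g : Ω → Ω) ∈ 𝒞


/-- The group `ℤ_2³ × ℤ_5`. -/
abbrev Hgrp : Type := Multiplicative ((ZMod 2 × ZMod 2 × ZMod 2) × ZMod 5)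

section

open Equiv Equiv.Perm MulAction

theorem five_dvd_of_zpow_apply_eq_self {X : Type*} {c : Perm X} (h5 : c ^ 5 = 1) {x : X}
    (hx : c x ≠ x) {n : ℤ} (hn : (c ^ n) x = x) : (5 : ℤ) ∣ n := by
  by_contra h
  have hcop : IsCoprime n 5 :=
    (((Nat.prime_iff_prime_int.mp (by norm_num : Nat.Prime 5)).coprime_iff_not_dvd).mpr h).symm
  obtain ⟨u, v, huv⟩ := hcop
  apply hx
  have h1 : c = (c ^ n) ^ u := by
    rw [← zpow_mul]
    calc c = c ^ (u * n + v * 5) := by rw [huv, zpow_one]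
      _ = c ^ (n * u) := by
        rw [zpow_add, mul_comm v, zpow_mul c 5 v, mul_comm u]
        norm_cast
        rw [h5, one_zpow, mul_one]
  rw [h1]
  exact zpow_apply_eq_self_of_apply_eq_self hn u

section EightPoints

variable {Ω : Type*}

theorem pow_five_isCycle [Fintype Ω] [DecidableEq Ω]
    (hΩ : Fintype.card Ω = 8) {σ : Perm Ω} (h5 : σ ^ 5 = 1) (h1 : σ ≠ 1) :
    σ.IsCycle ∧ σ.support.card = 5 := by
  have : Fact (Nat.Prime 5) := ⟨by norm_num⟩
  have ho : orderOf σ = 5 := orderOf_eq_prime h5 h1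
  obtain ⟨n, hn⟩ := cycleType_prime_order (σ := σ) (by rw [ho]; norm_num)
  have hs : σ.support.card = (n + 1) * 5 := by
    rw [← sum_cycleType, hn, ho, Multiset.sum_replicate, smul_eq_mul]
  have hle : σ.support.card ≤ 8 := hΩ ▸ Finset.card_le_univ _
  have hn0 : n = 0 := by omega
  subst hn0
  exact ⟨by rw [← card_cycleType_eq_one, hn]; simp, by omega⟩

theorem isMultiplyPretransitive_four [Fintype Ω] [DecidableEq Ω]
    (hΩ : Fintype.card Ω = 8) {M : Subgroup (Perm Ω)}
    (ht : IsPretransitive M Ω) {σ : Perm Ω} (hσ : σ ∈ M) (h5 : σ ^ 5 = 1) (h1 : σ ≠ 1) :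
    IsMultiplyPretransitive M Ω 4 ∧ IsPreprimitive M Ω := by
  obtain ⟨hc, hs⟩ := pow_five_isCycle hΩ h5 h1
  have hsc : ((σ.support : Set Ω)ᶜ).ncard = 3 := by
    have := Set.ncard_add_ncard_compl (σ.support : Set Ω)
    rw [Set.ncard_coe_finset, hs, Nat.card_eq_fintype_card, hΩ] at this
    omega
  have hpt := isPretransitive_of_isCycle_mem hc hσ
  have hcard : Nat.card (SubMulAction.ofFixingSubgroup M ((σ.support : Set Ω)ᶜ)) = 5 := by
    classical
    rw [Nat.card_eq_fintype_card, Fintype.card_subtype, ← hs]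
    congr 1
    ext x
    simp [SubMulAction.mem_ofFixingSubgroup_iff]
  have hpp : IsPreprimitive (fixingSubgroup M ((σ.support : Set Ω)ᶜ))
      (SubMulAction.ofFixingSubgroup M ((σ.support : Set Ω)ᶜ)) :=
    IsPreprimitive.of_prime_card (by rw [hcard]; norm_num)
  have hprim : IsPreprimitive M Ω := by
    refine IsPreprimitive.of_card_lt
      (f := SubMulAction.ofFixingSubgroup_equivariantMap M ((σ.support : Set Ω)ᶜ)) ?_
    have hinj : Function.Injective
      (SubMulAction.ofFixingSubgroup_equivariantMap M ((σ.support : Set Ω)ᶜ)) :=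
      fun x y h => Subtype.ext h
    rw [← Set.image_univ, Set.ncard_image_of_injective _ hinj, Set.ncard_univ, hcard,
      Nat.card_eq_fintype_card, hΩ]
    norm_num
  have := hprim.isMultiplyPreprimitive hsc (by rw [Nat.card_eq_fintype_card, hΩ]; norm_num) hpp
  exact ⟨IsMultiplyPreprimitive.isMultiplyPretransitive .., hprim⟩

theorem exists_mem_map_four {M : Subgroup (Perm Ω)} (hM : IsMultiplyPretransitive M Ω 4)
    {x y : Fin 4 → Ω} (hx : Function.Injective x) (hy : Function.Injective y) :
    ∃ g ∈ M, ∀ i, g (x i) = y i := by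
  obtain ⟨g, hg⟩ := MulAction.exists_smul_eq M (⟨x, hx⟩ : Fin 4 ↪ Ω) ⟨y, hy⟩
  exact ⟨g, g.2, fun i => DFunLike.congr_fun hg i⟩

theorem injective_vec_four {a b c d : Ω} (h : [a, b, c, d].Nodup) :
    Function.Injective ![a, b, c, d] := by
  simpa using List.nodup_ofFn.mp (by simpa using h : (List.ofFn ![a, b, c, d]).Nodup)

theorem mul_eq_swap_mul_swap_mul_of_fiveCycle [DecidableEq Ω] {σ g : Perm Ω} {x0 x1 x2 x3 x4 : Ω}
    (hn : [x0, x1, x2, x3, x4].Nodup) (s0 : σ x0 = x1) (s1 : σ x1 = x2) (s2 : σ x2 = x3)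
    (s3 : σ x3 = x4) (s4 : σ x4 = x0) (hf : ∀ y, y ∉ [x0, x1, x2, x3, x4] → σ y = y)
    (g0 : g x0 = x0) (g1 : g x1 = x1) (g2 : g x2 = x2) (g4 : g x4 = x3) (g3 : g x3 = x4) :
    g * σ = swap x3 x0 * swap x3 x4 * σ * g := by
  have ginj (y z) : g y = g z → y = z := fun h => g.injective h
  simp only [List.nodup_cons, List.mem_cons, List.not_mem_nil, or_false, not_or] at hn hf
  ext y
  by_cases hy : y ∉ [x0, x1, x2, x3, x4]
  · simp only [List.mem_cons, List.not_mem_nil, or_false, not_or] at hy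
    have h1 := hf y hy
    have h2 := hf (g y) (by grind)
    simp only [mul_apply, h1, h2]
    rw [swap_apply_of_ne_of_ne, swap_apply_of_ne_of_ne] <;> grind
  · simp only [List.mem_cons, List.not_mem_nil, or_false, not_not] at hy
    simp only [mul_apply, swap_apply_def]
    rcases hy with rfl | rfl | rfl | rfl | rfl <;>
      simp only [s0, s1, s2, s3, s4, g0, g1, g2, g3, g4] <;> grind

theorem mul_swap_mul_swap_mul_of_fiveCycle [DecidableEq Ω] {σ g : Perm Ω} {x0 x1 x2 x3 x4 : Ω}
    (hn : [x0, x1, x2, x3, x4].Nodup) (s0 : σ x0 = x1) (s1 : σ x1 = x2) (s2 : σ x2 = x3)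
    (s3 : σ x3 = x4) (s4 : σ x4 = x0) (hf : ∀ y, y ∉ [x0, x1, x2, x3, x4] → σ y = y)
    (g0 : g x0 = x0) (g1 : g x1 = x1) (g2 : g x2 = x2) (g4 : g x4 = x3) (g3 : g x3 ≠ x4) :
    σ * (swap x2 (g x3) * swap x3 x4) * g = g * σ := by
  have ginj (y z) : g y = g z → y = z := fun h => g.injective h
  simp only [List.nodup_cons, List.mem_cons, List.not_mem_nil, or_false, not_or] at hn hf
  have hw := hf (g x3) (by grind)
  ext y
  by_cases hy : y ∉ [x0, x1, x2, x3, x4]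
  · simp only [List.mem_cons, List.not_mem_nil, or_false, not_or] at hy
    have h1 := hf y hy
    by_cases h3 : g y = x4
    · simp only [mul_apply, h1, h3, swap_apply_right]
      rw [swap_apply_of_ne_of_ne] <;> grind
    have h2 := hf (g y) (by grind)
    simp only [mul_apply, h1]
    rw [swap_apply_of_ne_of_ne, swap_apply_of_ne_of_ne] <;> grind
  · simp only [List.mem_cons, List.not_mem_nil, or_false, not_not] at hy
    simp only [mul_apply, swap_apply_def]
    rcases hy with rfl | rfl | rfl | rfl | rfl <;>
      simp only [s0, s1, s2, s3, s4, g0, g1, g2, g4] <;> grind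

theorem swap_mul_swap_mul_conj_eq [DecidableEq Ω] {k : Perm Ω} {x0 x2 x3 x4 w : Ω}
    (h : [x0, x2, x3, x4, w].Nodup)
    (k0 : k x2 = x2) (k1 : k w = w) (k2 : k x3 = x3) (k3 : k x4 = x0) :
    swap x2 w * swap x3 x4 * (k * (swap x2 w * swap x3 x4) * k⁻¹) = swap x3 x4 * swap x3 x0 := by
  have e1 : k * swap x2 w * k⁻¹ = swap x2 w := by rw [← Equiv.swap_apply_apply, k0, k1]
  have e2 : k * swap x3 x4 * k⁻¹ = swap x3 x0 := by rw [← Equiv.swap_apply_apply, k2, k3]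
  rw [← conj_mul, e1, e2]
  simp only [List.nodup_cons, List.mem_cons, List.not_mem_nil, or_false, not_or] at h
  ext y
  simp only [mul_apply, swap_apply_def]
  grind

/-- A transitive permutation group of degree `8` containing an element of order `5` contains the
alternating group. -/
theorem alternatingGroup_le_of_pow_five_eq_one [Fintype Ω] [DecidableEq Ω]
    (hΩ : Fintype.card Ω = 8) {M : Subgroup (Perm Ω)}
    (ht : IsPretransitive M Ω) {σ : Perm Ω} (hσ : σ ∈ M) (h5 : σ ^ 5 = 1) (h1 : σ ≠ 1) :
    alternatingGroup Ω ≤ M := by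
  obtain ⟨hM, hprim⟩ := isMultiplyPretransitive_four hΩ ht hσ h5 h1
  obtain ⟨hc, hs⟩ := pow_five_isCycle hΩ h5 h1
  suffices ∃ g ∈ M, g.IsThreeCycle by
    obtain ⟨g, hg, h3⟩ := this
    exact alternatingGroup_le_of_isPreprimitive_of_isThreeCycle_mem hprim h3 hg
  obtain ⟨x, hx, -⟩ := hc
  have hval {m n : ℕ} (hmn : m < n) (hn : n < m + 5) : (σ ^ m) x ≠ (σ ^ n) x := by
    intro h
    have : (σ ^ ((n - m : ℕ) : ℤ)) x = x := by
      rw [zpow_natCast]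
      apply (σ ^ m).injective
      rw [← mul_apply, ← pow_add, h, Nat.add_sub_of_le hmn.le]
    have := five_dvd_of_zpow_apply_eq_self h5 hx this
    omega
  have h01 := hval (m := 0) (n := 1) (by norm_num) (by norm_num)
  have h02 := hval (m := 0) (n := 2) (by norm_num) (by norm_num)
  have h03 := hval (m := 0) (n := 3) (by norm_num) (by norm_num)
  have h04 := hval (m := 0) (n := 4) (by norm_num) (by norm_num)
  have h12 := hval (m := 1) (n := 2) (by norm_num) (by norm_num)
  have h13 := hval (m := 1) (n := 3) (by norm_num) (by norm_num)
  have h14 := hval (m := 1) (n := 4) (by norm_num) (by norm_num)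
  have h23 := hval (m := 2) (n := 3) (by norm_num) (by norm_num)
  have h24 := hval (m := 2) (n := 4) (by norm_num) (by norm_num)
  have h34 := hval (m := 3) (n := 4) (by norm_num) (by norm_num)
  have hst (n : ℕ) : σ ((σ ^ n) x) = (σ ^ (n + 1)) x := by rw [pow_succ']; rfl
  have s0 : σ x = (σ ^ 1) x := by simp
  have s1 := hst 1
  have s2 := hst 2
  have s3 := hst 3
  have s4 : σ ((σ ^ 4) x) = x := by rw [hst, h5, one_apply]
  rw [pow_zero, one_apply] at h01 h02 h03 h04
  have hsupp : {x, (σ ^ 1) x, (σ ^ 2) x, (σ ^ 3) x, (σ ^ 4) x} = σ.support := by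
    apply Finset.eq_of_subset_of_card_le
    · intro y hy
      simp only [Finset.mem_insert, Finset.mem_singleton] at hy
      rw [mem_support]
      rcases hy with rfl | rfl | rfl | rfl | rfl
      · exact hx
      · rw [s1]; exact h12.symm
      · rw [s2]; exact h23.symm
      · rw [s3]; exact h34.symm
      · rw [s4]; exact h04
    · rw [hs]
      rw [Finset.card_insert_of_notMem, Finset.card_insert_of_notMem,
        Finset.card_insert_of_notMem, Finset.card_insert_of_notMem, Finset.card_singleton] <;>
        simp only [Finset.mem_insert, Finset.mem_singleton, not_or] <;>
        tauto
  have hfix (y : Ω) (hy : y ∉ [x, (σ ^ 1) x, (σ ^ 2) x, (σ ^ 3) x, (σ ^ 4) x]) : σ y = y := by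
    rw [← notMem_support, ← hsupp]
    simpa using hy
  clear hsupp hval hst
  simp only [Nat.reduceAdd] at s1 s2 s3
  generalize (σ ^ 1) x = x1 at *
  generalize (σ ^ 2) x = x2 at *
  generalize (σ ^ 3) x = x3 at *
  generalize (σ ^ 4) x = x4 at *
  have hnd : [x, x1, x2, x3, x4].Nodup := by simp; tauto
  obtain ⟨g, hg, hgx⟩ := exists_mem_map_four hM (x := ![x, x1, x2, x4]) (y := ![x, x1, x2, x3])
    (injective_vec_four (by simp; tauto)) (injective_vec_four (by simp; tauto))
  have g0 : g x = x := hgx 0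
  have g1 : g x1 = x1 := hgx 1
  have g2 : g x2 = x2 := hgx 2
  have g4 : g x4 = x3 := hgx 3
  by_cases hw : g x3 = x4
  · refine ⟨g * σ * g⁻¹ * σ⁻¹, mul_mem (mul_mem (mul_mem hg hσ) (inv_mem hg)) (inv_mem hσ), ?_⟩
    have : g * σ * g⁻¹ * σ⁻¹ = swap x3 x * swap x3 x4 := by
      rw [mul_inv_eq_iff_eq_mul, mul_inv_eq_iff_eq_mul]
      exact mul_eq_swap_mul_swap_mul_of_fiveCycle hnd s0 s1 s2 s3 s4 hfix g0 g1 g2 g4 hw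
    rw [this]
    exact isThreeCycle_swap_mul_swap_same (Ne.symm h03) h34 h04
  · have hmem : swap x2 (g x3) * swap x3 x4 ∈ M := by
      have : swap x2 (g x3) * swap x3 x4 = σ⁻¹ * (g * σ * g⁻¹) := by
        rw [eq_inv_mul_iff_mul_eq, eq_mul_inv_iff_mul_eq]
        exact mul_swap_mul_swap_mul_of_fiveCycle hnd s0 s1 s2 s3 s4 hfix g0 g1 g2 g4 hw
      rw [this]
      exact mul_mem (inv_mem hσ) (mul_mem (mul_mem hg hσ) (inv_mem hg))
    have d2 : x2 ≠ g x3 := fun h => h23 (g.injective (g2.trans h))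
    have d3 : x3 ≠ g x3 := fun h => h34 (g.injective (h.symm.trans g4.symm))
    have d0 : x ≠ g x3 := fun h => h03 (g.injective (g0.trans h))
    generalize g x3 = w at *
    have hnd' : [x, x2, x3, x4, w].Nodup := by simp; tauto
    obtain ⟨k, hk, hkx⟩ := exists_mem_map_four hM (x := ![x2, w, x3, x4]) (y := ![x2, w, x3, x])
      (injective_vec_four (by simp; tauto)) (injective_vec_four (by simp; tauto))
    refine ⟨_, mul_mem hmem (mul_mem (mul_mem hk hmem) (inv_mem hk)), ?_⟩
    rw [swap_mul_swap_mul_conj_eq hnd' (hkx 0) (hkx 1) (hkx 2) (hkx 3)]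
    exact isThreeCycle_swap_mul_swap_same h34 (Ne.symm h03) (Ne.symm h04)

end EightPoints

section OrbitFive

variable {X : Type*} {c : Perm X}

theorem sameCycle_iff_exists_pow_of_pow_five (h5 : c ^ 5 = 1) {x y : X} :
    c.SameCycle x y ↔ ∃ i < 5, (c ^ i) x = y := by
  constructor
  · rintro ⟨n, rfl⟩
    refine ⟨(n % 5).toNat, by omega, ?_⟩
    rw [← zpow_natCast, Int.toNat_of_nonneg (by omega)]
    conv_rhs => rw [← Int.mul_ediv_add_emod n 5, zpow_add, zpow_mul]
    norm_cast
    rw [h5, one_zpow, one_mul]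
  · rintro ⟨i, -, rfl⟩
    exact ⟨i, by simp⟩

variable [DecidableEq X]

/-- The orbit of `x` under an element `c` of order five. -/
def orbitFive (c : Perm X) (x : X) : Finset X :=
  (Finset.range 5).image fun i => (c ^ i) x

theorem mem_orbitFive (h5 : c ^ 5 = 1) {x y : X} : y ∈ orbitFive c x ↔ c.SameCycle x y := by
  simp [orbitFive, sameCycle_iff_exists_pow_of_pow_five h5]

theorem card_orbitFive (h5 : c ^ 5 = 1) (hc : ∀ x, c x ≠ x) (x : X) :
    (orbitFive c x).card = 5 := by
  rw [orbitFive, Finset.card_image_of_injOn, Finset.card_range]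
  intro i hi j hj hij
  simp only [Finset.coe_range, Set.mem_Iio] at hi hj
  have : (c ^ ((i : ℤ) - j)) x = x := by
    have hij : (c ^ (i : ℤ)) x = (c ^ (j : ℤ)) x := by simpa using hij
    apply (c ^ (j : ℤ)).injective
    rw [← mul_apply, ← zpow_add, add_sub_cancel, hij]
  have := five_dvd_of_zpow_apply_eq_self h5 (hc x) this
  omega

theorem card_quotient_sameCycle [Fintype X] (hX : Fintype.card X = 40) (h5 : c ^ 5 = 1)
    (hc : ∀ x, c x ≠ x) [Fintype (Quotient (SameCycle.setoid c))] :
    Fintype.card (Quotient (SameCycle.setoid c)) = 8 := by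
  classical
  have h := Finset.card_eq_sum_card_fiberwise (s := Finset.univ) (t := Finset.univ)
    (f := (Quotient.mk (SameCycle.setoid c))) (fun _ _ => Finset.mem_coe.mpr (Finset.mem_univ _))
  rw [Finset.sum_congr rfl (g := fun _ => 5)] at h
  · rw [Finset.sum_const, Finset.card_univ, Finset.card_univ, hX, smul_eq_mul] at h
    omega
  · intro q _
    obtain ⟨x, rfl⟩ := Quotient.exists_rep q
    rw [← card_orbitFive h5 hc x]
    congr 1
    ext y
    rw [mem_orbitFive h5, Finset.mem_filter_univ, Quotient.eq]
    exact sameCycle_comm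

end OrbitFive

section Lift

variable {X : Type*}

theorem SameCycle.map_of_commute {c g : Perm X} (h : Commute g c) {x y : X}
    (hxy : c.SameCycle x y) : c.SameCycle (g x) (g y) := by
  obtain ⟨n, rfl⟩ := hxy
  exact ⟨n, by rw [← mul_apply, ← (h.zpow_right n).eq, mul_apply]⟩

/-- The action of the centralizer of `c` on the cycles of `c`. -/
def centralizerToPermQuotient (c : Perm X) :
    Subgroup.centralizer {c} →* Perm (Quotient (SameCycle.setoid c)) :=
  MonoidHom.toHomPerm
    { toFun := fun g => Quotient.map (g : Perm X) fun _ _ h =>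
        SameCycle.map_of_commute (Subgroup.mem_centralizer_singleton_iff.mp g.2) h
      map_one' := by
        refine funext fun q => ?_
        induction q using Quotient.inductionOn
        rfl
      map_mul' := fun g h => by
        refine funext fun q => ?_
        induction q using Quotient.inductionOn
        rfl }

theorem centralizerToPermQuotient_mk (c : Perm X) (g : Subgroup.centralizer {c}) (x : X) :
    centralizerToPermQuotient c g (Quotient.mk _ x) = Quotient.mk _ ((g : Perm X) x) :=
  rfl

/-- `c` is a fixed-point-free element of order five of `G` whose centralizer in `G` is
transitive. -/
structure IsCentrallyTransitive (G : Subgroup (Perm X)) (c : Perm X) : Prop where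
  mem : c ∈ G
  pow_five : c ^ 5 = 1
  apply_ne (x : X) : c x ≠ x
  exists_commute (x y : X) : ∃ g ∈ G, Commute g c ∧ g x = y

variable [Fintype X] {G : Subgroup (Perm X)} {c d : Perm X}

theorem IsCentrallyTransitive.exists_threeCycle_lift (hX : Fintype.card X = 40)
    (hc : IsCentrallyTransitive G c) (hd : d ∈ G) (hcd : Commute d c) (hd5 : d ^ 5 = 1) {p : X}
    (hp : ¬ c.SameCycle p (d p)) {x y z : X} (hxy : ¬ c.SameCycle x y) (hyz : ¬ c.SameCycle y z)
    (hxz : ¬ c.SameCycle x z) :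
    ∃ h ∈ G, Commute h c ∧ c.SameCycle (h x) y ∧ c.SameCycle (h y) z ∧ c.SameCycle (h z) x ∧
      ∀ t, ¬ c.SameCycle x t → ¬ c.SameCycle y t → ¬ c.SameCycle z t → h t = t := by
  classical
  set M := (G.subgroupOf (Subgroup.centralizer {c})).map (centralizerToPermQuotient c) with hM
  have hlift {m} (hm : m ∈ M) : ∃ g ∈ G, Commute g c ∧ ∀ n : ℕ, ∀ t,
      (m ^ n) (Quotient.mk _ t) = Quotient.mk _ ((g ^ n) t) := by
    obtain ⟨g, hg, rfl⟩ := hm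
    refine ⟨g, hg, Subgroup.mem_centralizer_singleton_iff.mp g.2, fun n t => ?_⟩
    rw [← map_pow, centralizerToPermQuotient_mk]
    rfl
  have hmem {g} (hg : g ∈ G) (hgc : Commute g c) : ∃ m ∈ M, ∀ t,
      m (Quotient.mk _ t) = Quotient.mk _ (g t) :=
    ⟨_, Subgroup.mem_map_of_mem _ (x := ⟨g, Subgroup.mem_centralizer_singleton_iff.mpr hgc⟩)
      (Subgroup.mem_subgroupOf.mpr hg), fun t => rfl⟩
  have ht : IsPretransitive M (Quotient (SameCycle.setoid c)) := by
    refine ⟨fun q r => ?_⟩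
    induction q using Quotient.inductionOn with | _ q
    induction r using Quotient.inductionOn with | _ r
    obtain ⟨g, hg, hgc, rfl⟩ := hc.exists_commute q r
    obtain ⟨m, hm, hmt⟩ := hmem hg hgc
    exact ⟨⟨m, hm⟩, hmt q⟩
  have halt : alternatingGroup (Quotient (SameCycle.setoid c)) ≤ M := by
    have hdc := Subgroup.mem_centralizer_singleton_iff.mpr hcd
    refine alternatingGroup_le_of_pow_five_eq_one
      (card_quotient_sameCycle hX hc.pow_five hc.apply_ne) ht
      (σ := centralizerToPermQuotient c ⟨d, hdc⟩)
      (Subgroup.mem_map_of_mem _ (Subgroup.mem_subgroupOf.mpr hd)) ?_ ?_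
    · rw [← map_pow, show (⟨d, hdc⟩ : Subgroup.centralizer {c}) ^ 5 = 1 from Subtype.ext hd5,
        map_one]
    · intro h
      have := DFunLike.congr_fun h (Quotient.mk _ p)
      exact hp (Quotient.exact this).symm
  have hne {s t : X} (h : ¬ c.SameCycle s t) :
      (Quotient.mk (SameCycle.setoid c) s) ≠ Quotient.mk _ t := fun h' => h (Quotient.exact h')
  set ω₁ := Quotient.mk (SameCycle.setoid c) x with h1
  set ω₂ := Quotient.mk (SameCycle.setoid c) y with h2
  set ω₃ := Quotient.mk (SameCycle.setoid c) z with h3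
  have h12 : ω₁ ≠ ω₂ := hne hxy
  have h23 : ω₂ ≠ ω₃ := hne hyz
  have h13 : ω₁ ≠ ω₃ := hne hxz
  set τ := swap ω₁ ω₂ * swap ω₂ ω₃ with hτ
  have hτ3 : τ.IsThreeCycle := by
    rw [hτ, swap_comm]
    exact isThreeCycle_swap_mul_swap_same h12.symm h23 h13
  obtain ⟨g, hg, hgc, hgt⟩ := hlift (halt hτ3.mem_alternatingGroup)
  have hτ10 : τ ^ 10 = τ := by
    have : τ ^ 3 = 1 := by rw [← hτ3.orderOf, pow_orderOf_eq_one]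
    rw [show 10 = 3 * 3 + 1 from rfl, pow_succ, pow_mul, this, one_pow, one_mul]
  have key (t : X) : τ (Quotient.mk _ t) = Quotient.mk _ ((g ^ 10) t) := by
    rw [← hgt 10 t, hτ10]
  refine ⟨g ^ 10, pow_mem hg 10, hgc.pow_left 10, ?_, ?_, ?_, fun t hxt hyt hzt => ?_⟩
  · refine Quotient.exact (s := SameCycle.setoid c) ((key x).symm.trans ?_)
    rw [← h1, ← h2, hτ, mul_apply, swap_apply_of_ne_of_ne h12 h13, swap_apply_left]
  · refine Quotient.exact (s := SameCycle.setoid c) ((key y).symm.trans ?_)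
    rw [← h2, ← h3, hτ, mul_apply, swap_apply_left, swap_apply_of_ne_of_ne h13.symm h23.symm]
  · refine Quotient.exact (s := SameCycle.setoid c) ((key z).symm.trans ?_)
    rw [← h3, ← h1, hτ, mul_apply, swap_apply_right, swap_apply_right]
  · have := hgt 1 t
    rw [pow_one, pow_one, hτ, mul_apply, swap_apply_of_ne_of_ne (hne hyt).symm (hne hzt).symm,
      swap_apply_of_ne_of_ne (hne hxt).symm (hne hyt).symm] at this
    obtain ⟨i, hi⟩ := Quotient.exact this
    have hn (n : ℕ) : (g ^ n) t = (c ^ (i * n)) t := by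
      induction n with
      | zero => simp
      | succ n ih =>
        rw [pow_succ, mul_apply, ← hi, ← mul_apply, ((hgc.pow_left n).zpow_right i).eq, mul_apply,
          ih, ← mul_apply, ← zpow_add]
        congr 2
        push_cast
        ring
    rw [hn, show i * ((10 : ℕ) : ℤ) = 5 * (2 * i) by push_cast; ring, zpow_mul]
    norm_cast
    rw [hc.pow_five, one_zpow, one_apply]

end Lift

section Commutator

variable {X : Type*}

theorem perm_inv_apply_self (g : Perm X) (x : X) : g⁻¹ (g x) = x := g.symm_apply_apply x

theorem perm_apply_inv_self (g : Perm X) (x : X) : g (g⁻¹ x) = x := g.apply_symm_apply x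

/-- `g` is the three-cycle `x ↦ y ↦ z ↦ x`. -/
structure IsTriangle (g : Perm X) (x y z : X) : Prop where
  fst : g x = y
  snd : g y = z
  trd : g z = x
  apply_eq (t : X) : t ≠ x → t ≠ y → t ≠ z → g t = t

theorem isTriangle_commutator {k w : Perm X} {z : X} (hk : k z ≠ z) (hw : w z ≠ z)
    (h : ∀ t, k t ≠ t → w t ≠ t → t = z) :
    IsTriangle (k * w * k⁻¹ * w⁻¹) z (k z) (w z) := by
  have hkm {t : X} (ht : k t ≠ t) (htz : t ≠ z) : w t = t := by
    by_contra h'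
    exact htz (h t ht h')
  have hwm {t : X} (ht : w t ≠ t) (htz : t ≠ z) : k t = t := by
    by_contra h'
    exact htz (h t h' ht)
  have hkinj {s t : X} (h : k s = k t) : s = t := k.injective h
  have hwinj {s t : X} (h : w s = w t) : s = t := w.injective h
  constructor
  · obtain ⟨s, hs⟩ := w.surjective z
    have hsz : s ≠ z := by rintro rfl; exact hw hs
    have hks : k s = s := hwm (by rw [hs]; exact hsz.symm) hsz
    simp only [mul_apply, inv_eq_iff_eq.mpr hs.symm, inv_eq_iff_eq.mpr hks.symm, hs]
  · have h1 : w (k z) = k z := hkm (fun h' => hk (hkinj h')) hk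
    have h2 : k (w z) = w z := hwm (fun h' => hw (hwinj h')) hw
    simp only [mul_apply, inv_eq_iff_eq.mpr h1.symm, perm_inv_apply_self, h2]
  · obtain ⟨s, hs⟩ := k.surjective z
    have hsz : s ≠ z := by rintro rfl; exact hk hs
    have hws : w s = s := hkm (by rw [hs]; exact hsz.symm) hsz
    simp only [mul_apply, perm_inv_apply_self, inv_eq_iff_eq.mpr hs.symm, hws, hs]
  · intro t h1 h2 h3
    by_cases hwt : w t = t
    · obtain ⟨s, rfl⟩ := k.surjective t
      have hws : w s = s := by
        by_cases hks : k s = s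
        · rwa [hks] at hwt
        · exact hkm hks (fun hsz => h2 (by rw [hsz]))
      simp only [mul_apply, inv_eq_iff_eq.mpr hwt.symm, perm_inv_apply_self, hws]
    · have hkt : k t = t := hwm hwt h1
      obtain ⟨s, rfl⟩ := w.surjective t
      have hks : k s = s := hwm (fun h' => hwt (by rw [h', h'])) (fun hsz => h3 (by rw [hsz]))
      simp only [mul_apply, perm_inv_apply_self, inv_eq_iff_eq.mpr hks.symm, hkt]

theorem commutator_apply_eq_self {k w : Perm X} {t : X} (h : k t = t ∨ w t = t)
    (hk : k (k⁻¹ t) = k⁻¹ t ∨ w (k⁻¹ t) = k⁻¹ t) (hw : k (w⁻¹ t) = w⁻¹ t ∨ w (w⁻¹ t) = w⁻¹ t) :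
    (k * w * k⁻¹ * w⁻¹) t = t := by
  simp only [mul_apply]
  by_cases hwt : w t = t
  · rw [inv_eq_iff_eq.mpr hwt.symm]
    rcases hk with hk | hk
    · rw [perm_apply_inv_self] at hk
      rw [← hk, hwt]
      exact (inv_eq_iff_eq.mp hk.symm).symm
    · rw [hk, perm_apply_inv_self]
  · have hkt : k t = t := h.resolve_right hwt
    rcases hw with hw | hw
    · rw [inv_eq_iff_eq.mpr hw.symm, perm_apply_inv_self, hkt]
    · rw [perm_apply_inv_self] at hw
      exact absurd (by rw [hw, perm_apply_inv_self, ← hw]) hwt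

end Commutator

section Commuting

variable {X : Type*} {a b : Perm X}

theorem SameCycle.pow_right_of_commute (hab : Commute a b) {t : X} (h : a.SameCycle t (b t))
    (n : ℕ) : a.SameCycle t ((b ^ n) t) := by
  induction n with
  | zero => exact SameCycle.refl _ _
  | succ n ih =>
    rw [pow_succ']
    exact h.trans (SameCycle.map_of_commute hab.symm ih)

theorem SameCycle.of_sameCycle_of_commute (hab : Commute a b) (hb5 : b ^ 5 = 1) {t s : X}
    (h : a.SameCycle t (b t)) (hs : b.SameCycle t s) : a.SameCycle t s := by
  obtain ⟨n, -, rfl⟩ := (sameCycle_iff_exists_pow_of_pow_five hb5).mp hs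
  exact SameCycle.pow_right_of_commute hab h n

theorem SameCycle.of_zpow_apply (hab : Commute a b) (hb5 : b ^ 5 = 1) {t : X} {j : ℤ}
    (hj : ¬ (5 : ℤ) ∣ j) (h : a.SameCycle t ((b ^ j) t)) : a.SameCycle t (b t) := by
  have hcop : IsCoprime j 5 :=
    (((Nat.prime_iff_prime_int.mp (by norm_num : Nat.Prime 5)).coprime_iff_not_dvd).mpr hj).symm
  obtain ⟨u, v, huv⟩ := hcop
  refine SameCycle.of_sameCycle_of_commute (hab.zpow_right j) ?_ h ⟨u, ?_⟩
  · rw [← zpow_natCast, ← zpow_mul, mul_comm, zpow_mul]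
    norm_cast
    rw [hb5, one_zpow]
  · rw [← zpow_mul]
    nth_rw 2 [← zpow_one b]
    rw [← huv, zpow_add, mul_comm v, zpow_mul b 5 v, mul_comm u]
    norm_cast
    rw [hb5, one_zpow, mul_one]

theorem SameCycle.symm_of_commute (hab : Commute a b) (ha5 : a ^ 5 = 1) (hb : ∀ x, b x ≠ x)
    {t : X} (h : a.SameCycle t (b t)) : b.SameCycle t (a t) := by
  obtain ⟨j, hj⟩ := h
  refine SameCycle.of_zpow_apply hab.symm ha5 (j := j) ?_ ⟨1, by rw [hj, zpow_one]⟩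
  rintro ⟨i, rfl⟩
  apply hb t
  rw [← hj, zpow_mul]
  norm_cast
  rw [ha5, one_zpow, one_apply]

theorem SameCycle.map_fixed_of_commute (hab : Commute a b) {t s : X} (h : a.SameCycle t (b t))
    (hs : a.SameCycle t s) : a.SameCycle s (b s) :=
  hs.symm.trans (h.trans (SameCycle.map_of_commute hab.symm hs))

theorem eq_of_sameCycle_of_sameCycle (hab : Commute a b) (hb5 : b ^ 5 = 1) {t s : X}
    (h : ¬ a.SameCycle t (b t)) (hs : a.SameCycle t s) (hs' : b.SameCycle t s) : t = s := by
  obtain ⟨j, rfl⟩ := hs'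
  by_cases hj : (5 : ℤ) ∣ j
  · obtain ⟨i, rfl⟩ := hj
    rw [zpow_mul]
    norm_cast
    rw [hb5, one_zpow, one_apply]
  · exact absurd (SameCycle.of_zpow_apply hab hb5 hj hs) h

end Commuting

section CommutingPair

variable {X : Type*} [Fintype X] {G : Subgroup (Perm X)} {a b : Perm X}

theorem exists_three_fixed_cycles (hX : Fintype.card X = 40) (ha : IsCentrallyTransitive G a)
    (hab : Commute a b) (hb5 : b ^ 5 = 1) {p : X} (hp : ¬ a.SameCycle p (b p)) :
    ∃ x y z : X, a.SameCycle x (b x) ∧ a.SameCycle y (b y) ∧ a.SameCycle z (b z) ∧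
      ¬ a.SameCycle x y ∧ ¬ a.SameCycle x z ∧ ¬ a.SameCycle y z := by
  classical
  have hbc := Subgroup.mem_centralizer_singleton_iff.mpr hab.symm
  set σ := centralizerToPermQuotient a ⟨b, hbc⟩ with hσ
  have hΩ := card_quotient_sameCycle hX ha.pow_five ha.apply_ne
  obtain ⟨-, hs⟩ := pow_five_isCycle hΩ (σ := σ)
    (by rw [hσ, ← map_pow, show (⟨b, hbc⟩ : Subgroup.centralizer {a}) ^ 5 = 1 from
      Subtype.ext hb5, map_one])
    (fun h => hp (Quotient.exact (DFunLike.congr_fun h (Quotient.mk _ p))).symm)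
  have hcard : (σ.supportᶜ).card = 3 := by
    rw [Finset.card_compl, hΩ, hs]
  obtain ⟨x, y, z, hxy, hxz, hyz, h⟩ := Finset.card_eq_three.mp hcard
  have hfix {q} (hq : q ∈ σ.supportᶜ) : σ q = q := by
    simpa using hq
  have hx := hfix (q := x) (by simp [h])
  have hy := hfix (q := y) (by simp [h])
  have hz := hfix (q := z) (by simp [h])
  induction x using Quotient.inductionOn with | _ x
  induction y using Quotient.inductionOn with | _ y
  induction z using Quotient.inductionOn with | _ z
  exact ⟨x, y, z, (Quotient.exact hx).symm, (Quotient.exact hy).symm, (Quotient.exact hz).symm,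
    fun h => hxy (Quotient.sound h), fun h => hxz (Quotient.sound h),
    fun h => hyz (Quotient.sound h)⟩

theorem exists_isTriangle_of_commute (hX : Fintype.card X = 40) (ha : IsCentrallyTransitive G a)
    (hb : IsCentrallyTransitive G b) (hab : Commute a b) {p : X} (hp : ¬ a.SameCycle p (b p)) :
    ∃ g ∈ G, ∃ x y z : X, IsTriangle g x y z ∧ ¬ a.SameCycle x y := by
  obtain ⟨d₁, d₂, d₃, hd1, hd2, hd3, h12, h13, h23⟩ :=
    exists_three_fixed_cycles hX ha hab hb.pow_five hp
  have hFa {t s : X} (h : a.SameCycle t (b t)) (hs : a.SameCycle t s) : a.SameCycle s (b s) :=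
    SameCycle.map_fixed_of_commute hab h hs
  have hba {t s : X} (h : a.SameCycle t (b t)) (hs : b.SameCycle t s) : a.SameCycle t s :=
    SameCycle.of_sameCycle_of_commute hab hb.pow_five h hs
  have hFb {t s : X} (h : a.SameCycle t (b t)) (hs : b.SameCycle t s) : a.SameCycle s (b s) :=
    hFa h (hba h hs)
  have hab' {t s : X} (h : a.SameCycle t (b t)) (hs : a.SameCycle t s) : b.SameCycle t s :=
    SameCycle.of_sameCycle_of_commute hab.symm ha.pow_five
      (SameCycle.symm_of_commute hab ha.pow_five hb.apply_ne h) hs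
  have heq {t s : X} (h : ¬ a.SameCycle t (b t)) (hs : a.SameCycle t s) (hs' : b.SameCycle t s) :
      t = s := eq_of_sameCycle_of_sameCycle hab hb.pow_five h hs hs'
  have hpF {d : X} (h : a.SameCycle d (b d)) : ¬ a.SameCycle p d := fun h' => hp (hFa h h'.symm)
  have hpFb {d : X} (h : a.SameCycle d (b d)) : ¬ b.SameCycle p d := fun h' => hp (hFb h h'.symm)
  have happ : a.SameCycle p (a p) := ⟨1, rfl⟩
  have hp' : ¬ a.SameCycle (a p) (b (a p)) := fun h => hp (hFa h happ.symm)
  have hbp : ¬ b.SameCycle p (a p) := fun h => ha.apply_ne p (heq hp happ h).symm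
  have hpb : ¬ b.SameCycle p (a p) := hbp
  obtain ⟨h, hh, hha, hp1, h1p, h2p, hfix⟩ := ha.exists_threeCycle_lift hX hb.mem hab.symm
    hb.pow_five hp (hpF hd1) h12 (hpF hd2)
  obtain ⟨h', hh', hhb, hp1', h1p', h2p', hfix'⟩ := hb.exists_threeCycle_lift hX ha.mem hab
    ha.pow_five hpb hbp (fun h => hp' (hFb hd3 h.symm)) (hpFb hd3)
  have hS (t : X) (ht : t ≠ p) (ht' : t ≠ a p) : h t = t ∨ h' t = t := by
    by_contra! hcon
    have hL : b.SameCycle p t ∨ b.SameCycle (a p) t ∨ b.SameCycle d₃ t := by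
      by_contra! hcon'
      exact hcon.2 (hfix' t hcon'.1 hcon'.2.1 hcon'.2.2)
    have hO : a.SameCycle p t ∨ a.SameCycle d₁ t ∨ a.SameCycle d₂ t := by
      by_contra! hcon'
      exact hcon.1 (hfix t hcon'.1 hcon'.2.1 hcon'.2.2)
    have hFt (hF : a.SameCycle t (b t)) (hd : ¬ a.SameCycle d₃ t) : False := by
      rcases hL with hL | hL | hL
      · exact hpFb hF hL
      · exact hp' (hFb hF hL.symm)
      · exact hd (hba hd3 hL)
    rcases hO with hO | hO | hO
    · rcases hL with hL | hL | hL
      · exact ht (heq hp hO hL).symm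
      · exact ht' (heq hp' (happ.symm.trans hO) hL).symm
      · exact hpF (hFb hd3 hL) hO
    · exact hFt (hFa hd1 hO) fun h3 => h13 (hO.trans h3.symm)
    · exact hFt (hFa hd2 hO) fun h3 => h23 (hO.trans h3.symm)
  set k := h * h' * h⁻¹ * h'⁻¹ with hk
  have hkG : k ∈ G := mul_mem (mul_mem (mul_mem hh hh') (inv_mem hh)) (inv_mem hh')
  set z := h' (a p) with hz
  set u := h' p with hu
  have hksupp (t : X) (ht : k t ≠ t) :
      t = p ∨ t = a p ∨ t = h p ∨ t = h (a p) ∨ t = u ∨ t = z := by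
    by_contra! hcon
    obtain ⟨t1, t2, t3, t4, t5, t6⟩ := hcon
    refine ht (commutator_apply_eq_self (hS t t1 t2) (hS _ ?_ ?_) (hS _ ?_ ?_)) <;>
      rw [Ne, inv_eq_iff_eq] <;> assumption
  have hzF : a.SameCycle z (b z) := hFb hd3 h1p'.symm
  have hkz : k z = a p := by
    have e1 : h'⁻¹ z = a p := perm_inv_apply_self _ _
    have e2 : a.SameCycle d₂ (h⁻¹ (a p)) := by
      have := SameCycle.map_of_commute hha.inv_left (h2p.trans happ)
      rwa [perm_inv_apply_self] at this
    have e3 : h' (h⁻¹ (a p)) = h⁻¹ (a p) := by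
      have hF := hFa hd2 e2
      exact hfix' _ (hpFb hF) (fun h => hp' (hFb hF h.symm))
        (fun h => h23 (e2.trans (hba hd3 h).symm))
    rw [hk, mul_apply, mul_apply, mul_apply, e1, e3, perm_apply_inv_self]
  have hbpow {i j : ℤ} (hij : a.SameCycle ((b ^ i) p) ((b ^ j) p)) : (5 : ℤ) ∣ j - i := by
    by_contra hcon
    have := SameCycle.map_of_commute (hab.symm.zpow_left (-i)) hij
    rw [← mul_apply, ← mul_apply, ← zpow_add, ← zpow_add, neg_add_cancel, zpow_zero, one_apply,
      neg_add_eq_sub] at this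
    exact hp (SameCycle.of_zpow_apply hab hb.pow_five hcon this)
  have hbF {i : ℤ} {d : X} (hd : a.SameCycle d (b d)) : ¬ a.SameCycle d ((b ^ i) p) := fun h =>
    hp (hFb (hFa hd h) ⟨-i, by rw [← mul_apply, ← zpow_add, neg_add_cancel, zpow_zero, one_apply]⟩)
  obtain ⟨i, hi⟩ : b.SameCycle (a p) u := hp1'.symm
  have hui : a.SameCycle u ((b ^ i) p) := by
    rw [← hi]
    exact SameCycle.map_of_commute (hab.symm.zpow_left i) happ.symm
  obtain ⟨e, f, he, hf, hef, hei, hfi⟩ : ∃ e f : ℤ, ¬ 5 ∣ e ∧ ¬ 5 ∣ f ∧ ¬ 5 ∣ f - e ∧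
      ¬ 5 ∣ e - i ∧ ¬ 5 ∣ f - i := by
    have : i % 5 = 0 ∨ i % 5 = 1 ∨ i % 5 = 2 ∨ i % 5 = 3 ∨ i % 5 = 4 := by omega
    rcases this with h | h | h | h | h
    · exact ⟨1, 2, by omega, by omega, by omega, by omega, by omega⟩
    · exact ⟨3, 2, by omega, by omega, by omega, by omega, by omega⟩
    · exact ⟨3, 1, by omega, by omega, by omega, by omega, by omega⟩
    · exact ⟨1, 2, by omega, by omega, by omega, by omega, by omega⟩
    · exact ⟨1, 2, by omega, by omega, by omega, by omega, by omega⟩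
  obtain ⟨w, hw, -, hwz, -, -, hwfix⟩ := ha.exists_threeCycle_lift hX hb.mem hab.symm
    hb.pow_five hp (x := z) (y := (b ^ e) p) (z := (b ^ f) p) (hbF hzF) (fun h => hef (hbpow h))
    (hbF hzF)
  have hcommon (t : X) (hkt : k t ≠ t) (hwt : w t ≠ t) : t = z := by
    have hpp {s : X} (hs : a.SameCycle p s) : w s = s := by
      refine hwfix s (fun h => hpF hzF (hs.trans h.symm)) (fun h => he ?_) (fun h => hf ?_)
      · have := hbpow (i := e) (j := 0) (h.trans hs.symm)
        omega
      · have := hbpow (i := f) (j := 0) (h.trans hs.symm)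
        omega
    have hdd {s : X} (hs : a.SameCycle d₁ s) : w s = s :=
      hwfix s (fun h => h13 (hs.trans (h.symm.trans (hba hd3 h1p'.symm).symm)))
        (fun h => hbF (hFa hd1 hs) h.symm) (fun h => hbF (hFa hd1 hs) h.symm)
    rcases hksupp t hkt with rfl | rfl | rfl | rfl | rfl | rfl
    · exact absurd (hpp (SameCycle.refl _ _)) hwt
    · exact absurd (hpp happ) hwt
    · exact absurd (hdd hp1.symm) hwt
    · exact absurd (hdd (hp1.symm.trans (SameCycle.map_of_commute hha happ))) hwt
    · refine absurd (hwfix u (fun h => hbF hzF (h.trans hui)) (fun h => hei ?_)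
        (fun h => hfi ?_)) hwt
      · have := hbpow (h.trans hui)
        omega
      · have := hbpow (h.trans hui)
        omega
    · rfl
  have hpz : ¬ a.SameCycle z (a p) := fun h => hp' (hFa hzF h)
  refine ⟨k * w * k⁻¹ * w⁻¹, mul_mem (mul_mem (mul_mem hkG hw) (inv_mem hkG)) (inv_mem hw),
    z, k z, w z, isTriangle_commutator ?_ ?_ hcommon, ?_⟩
  · rw [hkz]
    exact fun h => hpz (by rw [h])
  · intro h
    rw [h] at hwz
    exact hbF hzF hwz
  · rwa [hkz]

end CommutingPair

section ThreeCycleRelation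

variable {X : Type*} {G : Subgroup (Perm X)}

/-- The three-cycle `x ↦ y ↦ z ↦ x` belongs to `G`. -/
def HasTriangle (G : Subgroup (Perm X)) (x y z : X) : Prop :=
  x ≠ y ∧ ∃ g ∈ G, IsTriangle g x y z

theorem IsTriangle.eq {g g' : Perm X} {x y z : X} (h : IsTriangle g x y z)
    (h' : IsTriangle g' x y z) : g = g' := by
  ext t
  by_cases hx : t = x
  · rw [hx, h.fst, h'.fst]
  by_cases hy : t = y
  · rw [hy, h.snd, h'.snd]
  by_cases hz : t = z
  · rw [hz, h.trd, h'.trd]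
  rw [h.apply_eq t hx hy hz, h'.apply_eq t hx hy hz]

namespace HasTriangle

variable {x y z : X}

theorem ne_snd_trd (h : HasTriangle G x y z) : y ≠ z := by
  obtain ⟨hxy, g, -, hg⟩ := h
  exact fun hyz => hxy (g.injective (hg.fst.trans (hyz.trans hg.snd.symm)))

theorem rotate (h : HasTriangle G x y z) : HasTriangle G y z x :=
  ⟨h.ne_snd_trd, h.2.imp fun _ hg => ⟨hg.1, hg.2.snd, hg.2.trd, hg.2.fst,
    fun t h1 h2 h3 => hg.2.apply_eq t h3 h1 h2⟩⟩

theorem reverse (h : HasTriangle G x y z) : HasTriangle G y x z := by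
  refine ⟨h.1.symm, ?_⟩
  obtain ⟨-, g, hgG, hg⟩ := h
  exact ⟨g⁻¹, inv_mem hgG, by rw [inv_eq_iff_eq, hg.fst], by rw [inv_eq_iff_eq, hg.trd],
    by rw [inv_eq_iff_eq, hg.snd],
    fun t h1 h2 h3 => by rw [inv_eq_iff_eq, hg.apply_eq t h2 h1 h3]⟩

theorem map (h : HasTriangle G x y z) {σ : Perm X} (hσ : σ ∈ G) :
    HasTriangle G (σ x) (σ y) (σ z) := by
  obtain ⟨hxy, g, hgG, hg⟩ := h
  refine ⟨fun h => hxy (σ.injective h), σ * g * σ⁻¹, mul_mem (mul_mem hσ hgG) (inv_mem hσ), ?_⟩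
  refine ⟨?_, ?_, ?_, fun t h1 h2 h3 => ?_⟩
  · rw [mul_apply, mul_apply, perm_inv_apply_self, hg.fst]
  · rw [mul_apply, mul_apply, perm_inv_apply_self, hg.snd]
  · rw [mul_apply, mul_apply, perm_inv_apply_self, hg.trd]
  · obtain ⟨s, rfl⟩ := σ.surjective t
    rw [mul_apply, mul_apply, perm_inv_apply_self, hg.apply_eq s]
    all_goals rintro rfl; contradiction

end HasTriangle

/-- `x` and `y` are equal or moved by a common three-cycle of `G`. -/
def TriangleRel (G : Subgroup (Perm X)) (x y : X) : Prop :=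
  x = y ∨ ∃ z, HasTriangle G x y z

namespace TriangleRel

variable {x y w : X}

theorem refl (x : X) : TriangleRel G x x := Or.inl rfl

theorem symm (h : TriangleRel G x y) : TriangleRel G y x :=
  h.imp Eq.symm fun ⟨z, hz⟩ => ⟨z, hz.reverse⟩

theorem map (h : TriangleRel G x y) {σ : Perm X} (hσ : σ ∈ G) : TriangleRel G (σ x) (σ y) :=
  h.imp (congrArg σ) fun ⟨z, hz⟩ => ⟨σ z, hz.map hσ⟩

theorem map_iff {σ : Perm X} (hσ : σ ∈ G) : TriangleRel G (σ x) (σ y) ↔ TriangleRel G x y :=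
  ⟨fun h => by simpa [perm_inv_apply_self] using h.map (inv_mem hσ), fun h => h.map hσ⟩

theorem trans (h : TriangleRel G x y) (h' : TriangleRel G y w) : TriangleRel G x w := by
  rcases h with rfl | ⟨z, hz⟩
  · exact h'
  rcases h' with rfl | ⟨u, hu⟩
  · exact Or.inr ⟨z, hz⟩
  by_cases hxw : x = w
  · exact Or.inl hxw
  by_cases hxu : x = u
  · subst hxu
    exact Or.inr ⟨y, hu.rotate.reverse⟩
  obtain ⟨-, σ, hσ, hσt⟩ := hu
  have := hz.map hσ
  rw [hσt.fst, hσt.apply_eq x hz.1 hxw hxu] at this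
  exact Or.inr ⟨_, this⟩

theorem hasTriangle (h : TriangleRel G x y) (h' : TriangleRel G y w) (hxy : x ≠ y) (hyw : y ≠ w)
    (hxw : x ≠ w) : HasTriangle G x y w := by
  obtain ⟨z, hz⟩ := h.resolve_left hxy
  by_cases hzw : z = w
  · rwa [← hzw]
  have hrel : TriangleRel G z w := trans (Or.inr ⟨x, hz.rotate.reverse⟩) h'
  obtain ⟨v, hv⟩ := hrel.resolve_left hzw
  have hyz := hz.ne_snd_trd
  have hzx := hz.rotate.ne_snd_trd
  obtain ⟨-, σ, hσ, hσt⟩ := hv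
  by_cases hvx : v = x
  · subst hvx
    have := hz.map (inv_mem hσ)
    rw [inv_eq_iff_eq.mpr hσt.trd.symm, inv_eq_iff_eq.mpr hσt.snd.symm,
      inv_eq_iff_eq.mpr (hσt.apply_eq y hyz hyw hxy.symm).symm] at this
    exact this.rotate.rotate.reverse.rotate
  by_cases hvy : v = y
  · subst hvy
    have := hz.map (inv_mem hσ)
    rw [inv_eq_iff_eq.mpr hσt.trd.symm, inv_eq_iff_eq.mpr hσt.snd.symm,
      inv_eq_iff_eq.mpr (hσt.apply_eq x hzx.symm hxw hxy).symm] at this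
    exact this.rotate.rotate.reverse
  have := hz.map hσ
  rwa [hσt.fst, hσt.apply_eq x hzx.symm hxw (Ne.symm hvx),
    hσt.apply_eq y hyz hyw (Ne.symm hvy)] at this

end TriangleRel

theorem Equiv.Perm.IsThreeCycle.exists_isTriangle [Fintype X] [DecidableEq X] {σ : Perm X}
    (h : σ.IsThreeCycle) : ∃ x y z, x ≠ y ∧ y ≠ z ∧ x ≠ z ∧ IsTriangle σ x y z := by
  obtain ⟨x, hx, -⟩ := h.isCycle
  have h3 : σ ^ 3 = 1 := by rw [← h.orderOf, pow_orderOf_eq_one]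
  have hx3 : σ (σ (σ x)) = x := by simpa [pow_succ] using DFunLike.congr_fun h3 x
  have h12 : σ x ≠ σ (σ x) := fun h' => hx (σ.injective h').symm
  have h02 : x ≠ σ (σ x) := fun h' => hx (by rw [← h'] at hx3; exact hx3)
  refine ⟨x, σ x, σ (σ x), hx.symm, h12, h02, rfl, rfl, hx3, fun t h1 h2 h3 => ?_⟩
  by_contra ht
  have hsub : {t, x, σ x, σ (σ x)} ⊆ σ.support := by
    intro s hs
    simp only [Finset.mem_insert, Finset.mem_singleton] at hs
    rw [mem_support]
    rcases hs with rfl | rfl | rfl | rfl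
    · exact ht
    · exact hx
    · exact h12.symm
    · rwa [hx3]
  have := Finset.card_le_card hsub
  rw [h.card_support, Finset.card_insert_of_notMem, Finset.card_insert_of_notMem,
    Finset.card_insert_of_notMem, Finset.card_singleton] at this
  · omega
  all_goals simp only [Finset.mem_insert, Finset.mem_singleton, not_or]
  · exact h12
  · exact ⟨hx.symm, h02⟩
  · exact ⟨h1, h2, h3⟩

theorem mem_of_sign_eq_one_of_triangleRel [Fintype X] [DecidableEq X] {x : X} {f : Perm X}
    (hf : sign f = 1) (hx : ∀ t, f t ≠ t → TriangleRel G x t) : f ∈ G := by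
  classical
  have hmem (t : X) : TriangleRel G x (f t) ↔ TriangleRel G x t := by
    by_cases ht : f t = t
    · rw [ht]
    · exact iff_of_true (hx _ fun h => ht (f.injective h)) (hx t ht)
  have hle : alternatingGroup {t // TriangleRel G x t} ≤
      G.comap (ofSubtype (p := fun t => TriangleRel G x t)) := by
    rw [← closure_three_cycles_eq_alternating, Subgroup.closure_le]
    intro σ hσ
    obtain ⟨s, t, u, hst, htu, hsu, hσt⟩ := IsThreeCycle.exists_isTriangle hσ
    obtain ⟨-, g, hg, hgt⟩ := TriangleRel.hasTriangle (s.2.symm.trans t.2) (t.2.symm.trans u.2)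
      (Subtype.coe_ne_coe.mpr hst) (Subtype.coe_ne_coe.mpr htu) (Subtype.coe_ne_coe.mpr hsu)
    have : IsTriangle (ofSubtype σ) (s : X) t u := by
      refine ⟨?_, ?_, ?_, fun v h1 h2 h3 => ?_⟩
      · rw [ofSubtype_apply_coe, hσt.fst]
      · rw [ofSubtype_apply_coe, hσt.snd]
      · rw [ofSubtype_apply_coe, hσt.trd]
      · by_cases hv : TriangleRel G x v
        · have := hσt.apply_eq ⟨v, hv⟩ (fun h => h1 (congrArg Subtype.val h))
            (fun h => h2 (congrArg Subtype.val h)) (fun h => h3 (congrArg Subtype.val h))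
          exact (ofSubtype_apply_of_mem _ hv).trans (congrArg Subtype.val this)
        · exact ofSubtype_apply_of_not_mem _ hv
    rw [SetLike.mem_coe, Subgroup.mem_comap, this.eq hgt]
    exact hg
  have h1 : ofSubtype (f.subtypePerm hmem) = f :=
    ofSubtype_subtypePerm hmem hx
  rw [← h1]
  refine hle (mem_alternatingGroup.mpr ?_)
  rw [← sign_ofSubtype, h1, hf]

end ThreeCycleRelation

section Meets

variable {X : Type*} [Fintype X] {G : Subgroup (Perm X)} {a b : Perm X}

/-- Every class of `TriangleRel G` meets every cycle of `c`. -/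
def TriangleClassesMeet (G : Subgroup (Perm X)) (c : Perm X) : Prop :=
  ∀ s t, ∃ t', c.SameCycle t t' ∧ TriangleRel G s t'

theorem exists_not_sameCycle_three (hX : Fintype.card X = 40) (ha5 : a ^ 5 = 1)
    (ha : ∀ x, a x ≠ x) (x y z : X) :
    ∃ t, ¬ a.SameCycle x t ∧ ¬ a.SameCycle y t ∧ ¬ a.SameCycle z t := by
  classical
  have h : (orbitFive a x ∪ orbitFive a y ∪ orbitFive a z).card <
      (Finset.univ : Finset X).card := by
    have h1 := Finset.card_union_le (orbitFive a x ∪ orbitFive a y) (orbitFive a z)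
    have h2 := Finset.card_union_le (orbitFive a x) (orbitFive a y)
    rw [card_orbitFive ha5 ha, card_orbitFive ha5 ha] at h2
    rw [card_orbitFive ha5 ha] at h1
    rw [Finset.card_univ, hX]
    omega
  obtain ⟨t, -, ht⟩ := Finset.exists_mem_notMem_of_card_lt_card h
  simp only [Finset.mem_union, mem_orbitFive ha5, not_or] at ht
  exact ⟨t, ht.1.1, ht.1.2, ht.2⟩

theorem triangleClassesMeet_of_commute (hX : Fintype.card X = 40)
    (ha : IsCentrallyTransitive G a) (hb : IsCentrallyTransitive G b) (hab : Commute a b) {p : X}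
    (hp : ¬ a.SameCycle p (b p)) : TriangleClassesMeet G a := by
  obtain ⟨g, hg, x, y, z, ht, hxy⟩ := exists_isTriangle_of_commute hX ha hb hab hp
  have hr : TriangleRel G x y :=
    Or.inr ⟨z, fun h => hxy (h ▸ SameCycle.refl _ _), g, hg, ht⟩
  have key (t : X) : ∃ t', a.SameCycle t t' ∧ TriangleRel G x t' := by
    by_cases hxt : a.SameCycle x t
    · exact ⟨x, hxt.symm, TriangleRel.refl x⟩
    by_cases hyt : a.SameCycle y t
    · exact ⟨y, hyt.symm, hr⟩
    obtain ⟨v, hxv, hyv, htv⟩ := exists_not_sameCycle_three hX ha.pow_five ha.apply_ne x y t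
    obtain ⟨h, hh, -, h1, -, -, hfix⟩ :=
      ha.exists_threeCycle_lift hX hb.mem hab.symm hb.pow_five hp hyt htv hyv
    refine ⟨h y, h1.symm, ?_⟩
    have := hr.map hh
    rwa [hfix x (fun h => hxy h.symm) (fun h => hxt h.symm) (fun h => hxv h.symm)] at this
  intro s t
  obtain ⟨k, hk, hka, rfl⟩ := ha.exists_commute x s
  obtain ⟨t', ht', hxt'⟩ := key (k⁻¹ t)
  refine ⟨k t', ?_, hxt'.map hk⟩
  have := SameCycle.map_of_commute hka ht'
  rwa [perm_apply_inv_self] at this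

end Meets

section FivePower

theorem apply_eq_self_of_card_eq_five {α : Type*} [Fintype α] (hα : Fintype.card α = 5)
    {f : Function.End α} {n : ℕ} (hf : f ^ 5 ^ n = 1) {t : α} (ht : f t = t) (x : α) :
    f x = x := by
  classical
  have : Fact (Nat.Prime 5) := ⟨by norm_num⟩
  have hmod : 5 % 5 = Fintype.card (Function.fixedPoints f) % 5 := by
    have := card_fixedPoints_modEq hf
    rw [hα, Nat.ModEq] at this
    convert this
  have hpos : 0 < Fintype.card (Function.fixedPoints f) := Fintype.card_pos_iff.mpr ⟨⟨t, ht⟩⟩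
  have hle : Fintype.card (Function.fixedPoints f) ≤ 5 := by
    rw [← hα]
    exact set_fintype_card_le_univ _
  have h5 : Fintype.card (Function.fixedPoints f) = Fintype.card α := by
    omega
  have := (set_fintype_card_eq_univ_iff _).mp h5
  exact Set.eq_univ_iff_forall.mp this x

theorem apply_eq_self_of_mem_of_card_eq_five {X : Type*} {S : Finset X} (hS : S.card = 5)
    {g : Perm X} {n : ℕ} (hg : g ^ 5 ^ n = 1) (hgS : ∀ x, g x ∈ S ↔ x ∈ S) {t : X} (ht : t ∈ S)
    (hgt : g t = t) {x : X} (hx : x ∈ S) : g x = x := by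
  let f : Function.End S := fun y => ⟨g y, (hgS y).mpr y.2⟩
  have hpow (m : ℕ) (y : S) : ((f ^ m) y : X) = (g ^ m) y := by
    induction m generalizing y with
    | zero => rfl
    | succ m ih => rw [pow_succ, pow_succ]; exact ih _
  have := apply_eq_self_of_card_eq_five (α := S) (by simpa using hS)
    (f := f) (n := n)
    (by
      refine funext fun y => Subtype.ext ?_
      rw [hpow, hg]
      rfl) (t := ⟨t, ht⟩) (Subtype.ext hgt) ⟨x, hx⟩
  exact congrArg Subtype.val this

theorem exists_pow_pow_eq_self {M : Type*} [Group M] {b : M} (hb5 : b ^ 5 = 1) {i : ℕ}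
    (hi : i < 5) (hi0 : i ≠ 0) : ∃ u, (b ^ i) ^ u = b := by
  have h6 : b ^ 6 = b := by rw [pow_succ, hb5, one_mul]
  have h16 : b ^ 16 = b := by
    rw [show 16 = 5 * 3 + 1 from rfl, pow_succ, pow_mul, hb5, one_pow, one_mul]
  interval_cases i
  · exact absurd rfl hi0
  · exact ⟨1, by simp⟩
  · exact ⟨3, by rw [← pow_mul, h6]⟩
  · exact ⟨2, by rw [← pow_mul, h6]⟩
  · exact ⟨4, by rw [← pow_mul, h16]⟩

theorem IsPGroup.exists_pow_five_pow_eq_one {M : Type*} [Group M] {P : Subgroup M}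
    (hP : IsPGroup 5 P) {g : M} (hg : g ∈ P) : ∃ n : ℕ, g ^ 5 ^ n = 1 := by
  obtain ⟨n, hn⟩ := hP ⟨g, hg⟩
  exact ⟨n, congrArg Subtype.val hn⟩

end FivePower

section Preserving

variable {X : Type*} {a b : Perm X}

/-- `g` permutes the cycles of `c`. -/
def PreservesCycles (c g : Perm X) : Prop :=
  ∀ x y, c.SameCycle x y → c.SameCycle (g x) (g y)

/-- The permutations that permute the cycles of `c`, as a subgroup. -/
def cycleStabilizer (c : Perm X) : Subgroup (Perm X) where
  carrier := {g | ∀ x y, c.SameCycle (g x) (g y) ↔ c.SameCycle x y}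
  one_mem' := fun _ _ => Iff.rfl
  mul_mem' := fun hg hh x y => (hg _ _).trans (hh x y)
  inv_mem' := fun {g} hg x y => by
    have := hg (g⁻¹ x) (g⁻¹ y)
    rw [perm_apply_inv_self, perm_apply_inv_self] at this
    exact this.symm

theorem mem_cycleStabilizer_of_commute {c g : Perm X} (h : Commute g c) :
    g ∈ cycleStabilizer c := fun x y => by
  refine ⟨fun hxy => ?_, SameCycle.map_of_commute h⟩
  simpa [perm_inv_apply_self] using SameCycle.map_of_commute h.inv_left hxy

namespace PreservesCycles

theorem pow {c g : Perm X} (h : PreservesCycles c g) (n : ℕ) : PreservesCycles c (g ^ n) := by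
  induction n with
  | zero => exact fun _ _ => id
  | succ n ih => rw [pow_succ']; exact fun x y hxy => h _ _ (ih x y hxy)

theorem sameCycle_pow {c g : Perm X} (h : PreservesCycles c g) {t : X}
    (ht : c.SameCycle t (g t)) (n : ℕ) : c.SameCycle t ((g ^ n) t) := by
  induction n with
  | zero => exact SameCycle.refl _ _
  | succ n ih =>
    rw [pow_succ']
    exact ht.trans (h _ _ ih)

theorem eq_of_sameCycle (hab : PreservesCycles a b) (hb5 : b ^ 5 = 1) {t s : X}
    (h : ¬ a.SameCycle t (b t)) (hs : a.SameCycle t s) (hs' : b.SameCycle t s) : t = s := by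
  obtain ⟨i, hi, rfl⟩ := (sameCycle_iff_exists_pow_of_pow_five hb5).mp hs'
  by_cases hi0 : i = 0
  · simp [hi0]
  · obtain ⟨u, hu⟩ := exists_pow_pow_eq_self hb5 hi hi0
    have := sameCycle_pow (hab.pow i) hs u
    rw [hu] at this
    exact absurd this h

theorem inv_of_pow_five (hab : PreservesCycles a b) (hb5 : b ^ 5 = 1) : PreservesCycles a b⁻¹ := by
  rw [show b⁻¹ = b ^ 4 from inv_eq_of_mul_eq_one_left (by rw [← pow_succ, hb5])]
  exact hab.pow 4

theorem commute {P : Subgroup (Perm X)} (hP : IsPGroup 5 P) (haP : a ∈ P) (hbP : b ∈ P)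
    (ha5 : a ^ 5 = 1) (hb5 : b ^ 5 = 1) (ha : ∀ x, a x ≠ x) (hab : PreservesCycles a b)
    (hba : PreservesCycles b a) : Commute a b := by
  classical
  ext t
  rw [mul_apply, mul_apply]
  by_cases ht : a.SameCycle t (b t)
  · obtain ⟨j, hj⟩ := ht
    have hgP : (a ^ j)⁻¹ * b ∈ P := mul_mem (inv_mem (zpow_mem haP j)) hbP
    obtain ⟨n, hn⟩ := hP.exists_pow_five_pow_eq_one hgP
    have hgt : ((a ^ j)⁻¹ * b) t = t := by rw [mul_apply, ← hj, perm_inv_apply_self]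
    have hpres (x : X) (hx : x ∈ orbitFive a t) : ((a ^ j)⁻¹ * b) x ∈ orbitFive a t := by
      rw [mem_orbitFive ha5] at hx ⊢
      have h1 := hab _ _ hx
      rw [← hj, sameCycle_zpow_left] at h1
      refine h1.trans ⟨-j, ?_⟩
      rw [mul_apply, zpow_neg]
    have hfix {x : X} (hx : x ∈ orbitFive a t) : ((a ^ j)⁻¹ * b) x = x := by
      refine apply_eq_self_of_mem_of_card_eq_five (card_orbitFive ha5 ha t) hn (fun y => ?_)
        ((mem_orbitFive ha5).mpr (SameCycle.refl _ _)) hgt hx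
      refine ⟨fun hy => ?_, hpres y⟩
      have himg : (orbitFive a t).image ((a ^ j)⁻¹ * b : Perm X) = orbitFive a t := by
        refine Finset.eq_of_subset_of_card_le (fun z hz => ?_) ?_
        · obtain ⟨y, hy, rfl⟩ := Finset.mem_image.mp hz
          exact hpres y hy
        · rw [Finset.card_image_of_injective _ (Equiv.injective _)]
      rw [← himg, Finset.mem_image] at hy
      obtain ⟨z, hz, hzy⟩ := hy
      rwa [← Equiv.injective _ hzy]
    have h1 := hfix (x := a t) ((mem_orbitFive ha5).mpr ⟨1, rfl⟩)
    rw [mul_apply, inv_eq_iff_eq] at h1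
    rw [h1, ← hj, ← mul_apply, ← mul_apply, ← zpow_one_add, ← zpow_add_one, add_comm]
  · have h1 : ¬ a.SameCycle (b (a t)) (b (b (a t))) := by
      intro h
      have h2 := (hab.inv_of_pow_five hb5) _ _ h
      rw [perm_inv_apply_self, perm_inv_apply_self] at h2
      have h3 : a.SameCycle t (a t) := ⟨1, rfl⟩
      exact ht (h3.trans (h2.trans (hab _ _ h3).symm))
    refine (eq_of_sameCycle hab hb5 h1 ?_ ?_).symm
    · have h3 : a.SameCycle t (a t) := ⟨1, rfl⟩
      exact (hab _ _ h3).symm.trans ⟨1, rfl⟩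
    · have h3 : b.SameCycle t (b t) := ⟨1, rfl⟩
      exact SameCycle.trans (SameCycle.symm ⟨1, rfl⟩) (hba _ _ h3)

end PreservesCycles

theorem sameCycle_iff_of_forall [Finite X] (hab : PreservesCycles a b) (ha5 : a ^ 5 = 1)
    (hb5 : b ^ 5 = 1) (ha : ∀ x, a x ≠ x) (hb : ∀ x, b x ≠ x) (h : ∀ t, a.SameCycle t (b t))
    (s t : X) : a.SameCycle s t ↔ b.SameCycle s t := by
  classical
  have hsub : orbitFive b s ⊆ orbitFive a s := by
    intro y hy
    rw [mem_orbitFive hb5, sameCycle_iff_exists_pow_of_pow_five hb5] at hy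
    obtain ⟨i, -, rfl⟩ := hy
    exact (mem_orbitFive ha5).mpr (hab.sameCycle_pow (h s) i)
  rw [← mem_orbitFive ha5, ← mem_orbitFive hb5, Finset.eq_of_subset_of_card_le hsub
    (by rw [card_orbitFive ha5 ha, card_orbitFive hb5 hb])]

end Preserving

section Sylow

variable {X : Type*} {G P : Subgroup (Perm X)} {c : Perm X}

theorem IsCentrallyTransitive.conj (hc : IsCentrallyTransitive G c) {g : Perm X} (hg : g ∈ G) :
    IsCentrallyTransitive G (g * c * g⁻¹) where
  mem := mul_mem (mul_mem hg hc.mem) (inv_mem hg)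
  pow_five := by rw [conj_pow, hc.pow_five, mul_one, mul_inv_cancel]
  apply_ne x h := by
    rw [mul_apply, mul_apply] at h
    exact hc.apply_ne (g⁻¹ x) (by rw [eq_inv_iff_eq, h])
  exists_commute x y := by
    obtain ⟨k, hk, hkc, hkx⟩ := hc.exists_commute (g⁻¹ x) (g⁻¹ y)
    refine ⟨g * k * g⁻¹, mul_mem (mul_mem hg hk) (inv_mem hg), ?_, ?_⟩
    · have := hkc.map (MulAut.conj g)
      exact this
    · rw [mul_apply, mul_apply, hkx, perm_apply_inv_self]

theorem preservesCycles_or_triangleClassesMeet [Fintype X] (hX : Fintype.card X = 40)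
    (hPG : P ≤ G)
    (hP : IsPGroup 5 P) (hc : IsCentrallyTransitive G c) (hcP : c ∈ P) :
    (∀ g ∈ P, PreservesCycles c g) ∨ TriangleClassesMeet G c := by
  classical
  have : Fact (Nat.Prime 5) := ⟨by norm_num⟩
  by_contra! hcon
  obtain ⟨⟨g₀, hg₀, hg₀'⟩, hmeet⟩ := hcon
  let U : Subgroup P := (cycleStabilizer c).subgroupOf P
  have hU : U < ⊤ := by
    refine lt_top_iff_ne_top.mpr fun h => hg₀' fun x y hxy => ?_
    have : (⟨g₀, hg₀⟩ : P) ∈ U := h ▸ Subgroup.mem_top _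
    exact (this x y).mpr hxy
  have hnil : Group.IsNilpotent P := hP.isNilpotent
  obtain ⟨-, hnorm⟩ := SetLike.lt_iff_le_and_exists.mp
    (Group.normalizerCondition_of_isNilpotent U hU)
  obtain ⟨g, hgN, hgU⟩ := hnorm
  have hcU : (⟨c, hcP⟩ : P) ∈ U := fun x y => by
    change c.SameCycle (c x) (c y) ↔ c.SameCycle x y
    simp
  have h1 : g * ⟨c, hcP⟩ * g⁻¹ ∈ U := (Subgroup.mem_normalizer_iff.mp hgN _).mp hcU
  have h2 : g⁻¹ * ⟨c, hcP⟩ * g ∈ U := (Subgroup.mem_normalizer_iff''.mp hgN _).mp hcU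
  obtain ⟨g, hgP⟩ := g
  have hc' := hc.conj (hPG hgP)
  have hp1 : PreservesCycles c (g * c * g⁻¹) := fun x y hxy => (h1 x y).mpr hxy
  have hp2 : PreservesCycles (g * c * g⁻¹) c := fun x y hxy => by
    rw [sameCycle_conj] at hxy ⊢
    have := (h2 _ _).mpr hxy
    change c.SameCycle ((g⁻¹ * c * g) (g⁻¹ x)) ((g⁻¹ * c * g) (g⁻¹ y)) at this
    simpa [perm_apply_inv_self] using this
  have hcomm := hp1.commute hP hcP (mul_mem (mul_mem hgP hcP) (inv_mem hgP)) hc.pow_five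
    hc'.pow_five hc.apply_ne hp2
  obtain ⟨p, hp⟩ : ∃ p, ¬ c.SameCycle p ((g * c * g⁻¹) p) := by
    by_contra! hall
    have heq := sameCycle_iff_of_forall hp1 hc.pow_five hc'.pow_five hc.apply_ne hc'.apply_ne hall
    refine hgU fun x y => ?_
    change c.SameCycle (g x) (g y) ↔ c.SameCycle x y
    rw [heq, sameCycle_conj, perm_inv_apply_self, perm_inv_apply_self]
  exact hmeet (triangleClassesMeet_of_commute hX hc hc' hcomm hp)

end Sylow

section Conjugation

variable {X : Type*} {a b : Perm X}

theorem sameCycle_map_iff_of_apply (ha5 : a ^ 5 = 1) (hb5 : b ^ 5 = 1) (ha : ∀ x, a x ≠ x)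
    (hb : ∀ x, b x ≠ x) {δ : Perm X} (h : ∀ s, b.SameCycle (δ s) (δ (a s))) (s t : X) :
    a.SameCycle s t ↔ b.SameCycle (δ s) (δ t) := by
  classical
  have hpow (n : ℕ) : b.SameCycle (δ s) (δ ((a ^ n) s)) := by
    induction n with
    | zero => exact SameCycle.refl _ _
    | succ n ih => rw [pow_succ']; exact ih.trans (h _)
  have himp {t : X} (hst : a.SameCycle s t) : b.SameCycle (δ s) (δ t) := by
    obtain ⟨n, -, rfl⟩ := (sameCycle_iff_exists_pow_of_pow_five ha5).mp hst
    exact hpow n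
  have himg : (orbitFive a s).image δ = orbitFive b (δ s) := by
    refine Finset.eq_of_subset_of_card_le (fun z hz => ?_) ?_
    · obtain ⟨y, hy, rfl⟩ := Finset.mem_image.mp hz
      exact (mem_orbitFive hb5).mpr (himp ((mem_orbitFive ha5).mp hy))
    · rw [Finset.card_image_of_injective _ δ.injective, card_orbitFive ha5 ha,
        card_orbitFive hb5 hb]
  rw [← mem_orbitFive ha5, ← mem_orbitFive hb5, ← himg,
    Function.Injective.mem_finset_image δ.injective]

variable [Fintype X]

theorem cycleType_of_pow_five [DecidableEq X] (hX : Fintype.card X = 40) (ha5 : a ^ 5 = 1)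
    (ha : ∀ x, a x ≠ x) : a.cycleType = Multiset.replicate 8 5 := by
  have : Fact (Nat.Prime 5) := ⟨by norm_num⟩
  have hs : a.support = Finset.univ := Finset.eq_univ_of_forall fun x => mem_support.mpr (ha x)
  have h1 : a ≠ 1 := by
    rintro rfl
    rw [support_one] at hs
    have := congrArg Finset.card hs
    rw [Finset.card_empty, Finset.card_univ, hX] at this
    omega
  have ho : orderOf a = 5 := orderOf_eq_prime ha5 h1
  obtain ⟨n, hn⟩ := cycleType_prime_order (σ := a) (by rw [ho]; norm_num)
  have hcard : a.support.card = (n + 1) * 5 := by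
    rw [← sum_cycleType, hn, ho, Multiset.sum_replicate, smul_eq_mul]
  rw [hs, Finset.card_univ, hX] at hcard
  rw [hn, ho, show n + 1 = 8 by omega]

theorem exists_sameCycle_map_iff_of_alternatingGroup_le [DecidableEq X]
    (hX : Fintype.card X = 40) {G : Subgroup (Perm X)} (hG : alternatingGroup X ≤ G)
    (ha5 : a ^ 5 = 1) (hb5 : b ^ 5 = 1) (ha : ∀ x, a x ≠ x) (hb : ∀ x, b x ≠ x) :
    ∃ δ ∈ G, ∀ s t, a.SameCycle s t ↔ b.SameCycle (δ s) (δ t) := by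
  obtain ⟨δ, hδ⟩ := isConj_iff.mp (isConj_iff_cycleType_eq.mpr
    ((cycleType_of_pow_five hX ha5 ha).trans (cycleType_of_pow_five hX hb5 hb).symm))
  have hiff (s t : X) : a.SameCycle s t ↔ b.SameCycle (δ s) (δ t) := by
    rw [← hδ, sameCycle_conj, perm_inv_apply_self, perm_inv_apply_self]
  rcases Int.units_eq_one_or (sign δ) with h | h
  · exact ⟨δ, hG (mem_alternatingGroup.mpr h), hiff⟩
  · obtain ⟨x⟩ : Nonempty X := Fintype.card_pos_iff.mp (by omega)
    have hswap (s : X) : a.SameCycle s (swap x (a x) s) := by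
      by_cases h1 : s = x
      · rw [h1, swap_apply_left]
        exact ⟨1, rfl⟩
      by_cases h2 : s = a x
      · rw [h2, swap_apply_right]
        exact SameCycle.symm ⟨1, rfl⟩
      rw [swap_apply_of_ne_of_ne h1 h2]
    refine ⟨δ * swap x (a x), hG (mem_alternatingGroup.mpr ?_), fun s t => ?_⟩
    · rw [Perm.sign_mul, h, sign_swap (ha x).symm]
      rfl
    · rw [mul_apply, mul_apply, ← hiff]
      exact ⟨fun hst => (hswap s).symm.trans (hst.trans (hswap t)),
        fun hst => (hswap s).trans (hst.trans (hswap t).symm)⟩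

end Conjugation

section Transversal

variable {X : Type*} {G P : Subgroup (Perm X)} {a b : Perm X}

theorem alternatingGroup_le_of_triangleRel_zpow [Fintype X] [DecidableEq X]
    (ha : IsCentrallyTransitive G a)
    (hm : TriangleClassesMeet G a) {x : X} {j : ℤ} (hj : ¬ (5 : ℤ) ∣ j)
    (hx : TriangleRel G x ((a ^ j) x)) : alternatingGroup X ≤ G := by
  have hcop : IsCoprime j 5 :=
    (((Nat.prime_iff_prime_int.mp (by norm_num : Nat.Prime 5)).coprime_iff_not_dvd).mpr hj).symm
  obtain ⟨u, v, huv⟩ := hcop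
  have hau : (a ^ j) ^ u = a := by
    rw [← zpow_mul]
    nth_rw 2 [← zpow_one a]
    rw [← huv, zpow_add, mul_comm v, zpow_mul a 5 v, mul_comm u]
    norm_cast
    rw [ha.pow_five, one_zpow, mul_one]
  have hnat (g : Perm X) (hg : g ∈ G) (hgx : TriangleRel G x (g x)) (n : ℕ) :
      TriangleRel G x ((g ^ n) x) := by
    induction n with
    | zero => exact TriangleRel.refl x
    | succ n ih => rw [pow_succ']; exact hgx.trans (ih.map hg)
  have hfive : (a ^ j) ^ 5 = 1 := by
    rw [← zpow_natCast, ← zpow_mul, mul_comm, zpow_mul]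
    norm_cast
    rw [ha.pow_five, one_zpow]
  have hall (t : X) : TriangleRel G x t := by
    obtain ⟨t', ht', hxt'⟩ := hm x t
    obtain ⟨n, rfl⟩ := ht'.symm
    have hn : TriangleRel G x ((a ^ n) x) := by
      obtain ⟨i, -, hi⟩ := (sameCycle_iff_exists_pow_of_pow_five hfive).mp
        (⟨u * n, by rw [zpow_mul, hau]⟩ : (a ^ j).SameCycle x ((a ^ n) x))
      rw [← hi]
      exact hnat _ (zpow_mem ha.mem j) hx i
    exact hn.trans (hxt'.map (zpow_mem ha.mem n))
  exact fun f hf => mem_of_sign_eq_one_of_triangleRel (mem_alternatingGroup.mp hf)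
    fun t _ => hall t

theorem TriangleRel.pow_apply {g h : Perm X} (hg : g ∈ G)
    (hgh : ∀ y, TriangleRel G (g y) (h y)) (n : ℕ) (y : X) :
    TriangleRel G ((g ^ n) y) ((h ^ n) y) := by
  induction n with
  | zero => exact TriangleRel.refl y
  | succ n ih =>
    rw [pow_succ', pow_succ', mul_apply, mul_apply]
    exact (ih.map hg).trans (hgh _)

theorem exists_mem_eq_on_class [Fintype X] (hP : IsPGroup 5 P) {f : Perm X} (hf : f ∈ P)
    (hfr : ∀ y, TriangleRel G (f y) y) (x : X) :
    ∃ d ∈ G, (∀ y, TriangleRel G x y → d y = f y) ∧ ∀ y, ¬ TriangleRel G x y → d y = y := by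
  classical
  have hmem (y : X) : TriangleRel G x (f y) ↔ TriangleRel G x y :=
    ⟨fun h => h.trans (hfr y), fun h => h.trans (hfr y).symm⟩
  have hout (y : X) (hy : ¬ TriangleRel G x y) : ofSubtype (f.subtypePerm hmem) y = y :=
    ofSubtype_apply_of_not_mem _ hy
  refine ⟨ofSubtype (f.subtypePerm hmem), ?_, fun y hy => ?_, hout⟩
  · refine mem_of_sign_eq_one_of_triangleRel (x := x) ?_ fun t ht => ?_
    · obtain ⟨n, hn⟩ := hP.exists_pow_five_pow_eq_one hf
      have h1 : sign (ofSubtype (f.subtypePerm hmem)) ^ 5 ^ n = 1 := by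
        rw [← map_pow, ← map_pow]
        have : (f.subtypePerm hmem) ^ 5 ^ n = 1 := by
          rw [subtypePerm_pow]
          ext y
          simp [hn]
        rw [this, map_one, map_one]
      rcases Int.units_eq_one_or (sign (ofSubtype (f.subtypePerm hmem))) with h | h
      · exact h
      · rw [h, (Odd.pow (by decide : Odd 5)).neg_one_pow] at h1
        exact absurd h1 (by decide)
    · by_contra h
      exact ht (hout t h)
  · exact ofSubtype_apply_of_mem _ hy

theorem exists_pow_triangleRel (hPG : P ≤ G) (hP : IsPGroup 5 P) (ha : IsCentrallyTransitive G a)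
    (haP : a ∈ P) (hm : TriangleClassesMeet G a)
    (ht : ∀ x, ∀ j : ℤ, TriangleRel G x ((a ^ j) x) → (5 : ℤ) ∣ j) {g : Perm X} (hg : g ∈ P)
    (x₀ : X) : ∃ j < 5, ∀ y, TriangleRel G (g y) ((a ^ j) y) := by
  classical
  have hcov (y : X) : ∃ k < 5, TriangleRel G y ((a ^ k) x₀) := by
    obtain ⟨t', ht', hy⟩ := hm y x₀
    obtain ⟨k, hk, rfl⟩ := (sameCycle_iff_exists_pow_of_pow_five ha.pow_five).mp ht'
    exact ⟨k, hk, hy⟩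
  obtain ⟨j, hj, hjx⟩ := hcov (g x₀)
  refine ⟨j, hj, ?_⟩
  let s : Setoid X := ⟨TriangleRel G, TriangleRel.refl, TriangleRel.symm, TriangleRel.trans⟩
  have hbij : Function.Bijective fun i : Fin 5 => (Quotient.mk s ((a ^ (i : ℕ)) x₀)) := by
    refine ⟨fun k l hkl => ?_, fun q => ?_⟩
    · have hkl : TriangleRel G ((a ^ (k : ℕ)) x₀) ((a ^ (l : ℕ)) x₀) := Quotient.exact hkl
      have := ht ((a ^ (k : ℕ)) x₀) ((l : ℤ) - k) (by
        rw [← zpow_natCast, ← zpow_natCast] at hkl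
        rwa [← zpow_natCast, ← mul_apply, ← zpow_add, sub_add_cancel])
      have := k.2
      have := l.2
      ext
      omega
    · induction q using Quotient.inductionOn with | _ y
      obtain ⟨k, hk, hy⟩ := hcov y
      exact ⟨⟨k, hk⟩, Quotient.sound hy.symm⟩
  have : Fintype (Quotient s) := Fintype.ofBijective _ hbij
  have hcard : Fintype.card (Quotient s) = 5 := by
    rw [← Fintype.card_of_bijective hbij, Fintype.card_fin]
  have hg'P : (a ^ j)⁻¹ * g ∈ P := mul_mem (inv_mem (pow_mem haP j)) hg
  set g' := (a ^ j)⁻¹ * g with hg'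
  obtain ⟨n, hn⟩ := hP.exists_pow_five_pow_eq_one hg'P
  let f : Function.End (Quotient s) :=
    Quotient.map g' fun _ _ (h : TriangleRel G _ _) => h.map (hPG hg'P)
  have hfpow (m : ℕ) (y : X) : (f ^ m) (Quotient.mk s y) = Quotient.mk s ((g' ^ m) y) := by
    induction m generalizing y with
    | zero => rfl
    | succ m ih => rw [pow_succ, pow_succ]; exact ih (g' y)
  have hback {y : X} : TriangleRel G (g' y) y ↔ TriangleRel G (g y) ((a ^ j) y) := by
    rw [← TriangleRel.map_iff (pow_mem ha.mem j), hg', mul_apply, perm_apply_inv_self]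
  intro y
  rw [← hback]
  refine Quotient.exact (s := s) (apply_eq_self_of_card_eq_five hcard (f := f) (n := n) ?_
    (t := Quotient.mk s x₀) (Quotient.sound (hback.mpr hjx)) (Quotient.mk s y))
  refine funext fun q => ?_
  induction q using Quotient.inductionOn with | _ y
  rw [hfpow, hn]
  rfl

theorem not_forall_triangleRel_apply [Fintype X] (hX : Fintype.card X = 40)
    (ha : IsCentrallyTransitive G a) (hm : TriangleClassesMeet G a)
    (ht : ∀ x, ∀ j : ℤ, TriangleRel G x ((a ^ j) x) → (5 : ℤ) ∣ j) (hb5 : b ^ 5 = 1)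
    (hb : ∀ x, b x ≠ x) : ¬ ∀ y, TriangleRel G (b y) y := by
  classical
  intro h
  have : Fact (Nat.Prime 5) := ⟨by norm_num⟩
  obtain ⟨x₀⟩ : Nonempty X := Fintype.card_pos_iff.mp (by omega)
  have hbij : Function.Bijective fun y : {y // TriangleRel G x₀ y} =>
      Quotient.mk (SameCycle.setoid a) (y : X) := by
    refine ⟨fun y z hyz => ?_, fun q => ?_⟩
    · obtain ⟨n, hn⟩ : a.SameCycle (y : X) z := Quotient.exact hyz
      obtain ⟨m, rfl⟩ := ht y n (hn ▸ y.2.symm.trans z.2)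
      rw [zpow_mul] at hn
      norm_cast at hn
      rw [ha.pow_five, one_zpow, one_apply] at hn
      exact Subtype.ext hn
    · induction q using Quotient.inductionOn with | _ t
      obtain ⟨t', ht', hr⟩ := hm x₀ t
      exact ⟨⟨t', hr⟩, Quotient.sound ht'.symm⟩
  have hcard : Fintype.card {y // TriangleRel G x₀ y} = 8 := by
    rw [Fintype.card_of_bijective hbij, card_quotient_sameCycle hX ha.pow_five ha.apply_ne]
  let f : Function.End {y // TriangleRel G x₀ y} := fun y => ⟨b y, y.2.trans (h y).symm⟩
  have hfpow (m : ℕ) (y) : ((f ^ m) y : X) = (b ^ m) y := by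
    induction m generalizing y with
    | zero => rfl
    | succ m ih => rw [pow_succ, pow_succ]; exact ih _
  have hf : f ^ 5 ^ 1 = 1 := by
    refine funext fun y => Subtype.ext ?_
    rw [hfpow, pow_one, hb5]
    rfl
  have hmod := card_fixedPoints_modEq hf
  have : IsEmpty (Function.fixedPoints f) :=
    ⟨fun y => hb y.1 (congrArg Subtype.val y.2)⟩
  rw [hcard, Fintype.card_eq_zero] at hmod
  exact absurd hmod (by decide)

theorem exists_sameCycle_map_iff_of_transversal [Fintype X] (hX : Fintype.card X = 40)
    (hPG : P ≤ G)
    (hP : IsPGroup 5 P) (ha : IsCentrallyTransitive G a) (hb : IsCentrallyTransitive G b)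
    (haP : a ∈ P) (hbP : b ∈ P) (hm : TriangleClassesMeet G a)
    (ht : ∀ x, ∀ j : ℤ, TriangleRel G x ((a ^ j) x) → (5 : ℤ) ∣ j) :
    ∃ δ ∈ G, ∀ s t, a.SameCycle s t ↔ b.SameCycle (δ s) (δ t) := by
  obtain ⟨x₀⟩ : Nonempty X := Fintype.card_pos_iff.mp (by omega)
  obtain ⟨j, hj, hbj⟩ := exists_pow_triangleRel hPG hP ha haP hm ht hbP x₀
  have hj0 : j ≠ 0 := by
    rintro rfl
    exact not_forall_triangleRel_apply hX ha hm ht hb.pow_five hb.apply_ne hbj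
  obtain ⟨u, hu⟩ := exists_pow_pow_eq_self ha.pow_five hj hj0
  have hβ (y : X) : TriangleRel G ((b ^ u) y) (a y) := by
    have := TriangleRel.pow_apply hb.mem hbj u y
    rwa [hu] at this
  have hβP : b ^ u ∈ P := pow_mem hbP u
  have hβ5 : (b ^ u) ^ 5 = 1 := by rw [← pow_mul, mul_comm, pow_mul, hb.pow_five, one_pow]
  have hβb (s : X) : b.SameCycle s ((b ^ u) s) := ⟨u, by rw [zpow_natCast]⟩
  generalize b ^ u = β at *
  have hfP (k : ℕ) : β ^ k * (a ^ k)⁻¹ ∈ P := mul_mem (pow_mem hβP k) (inv_mem (pow_mem haP k))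
  have hfr (k : ℕ) (y : X) : TriangleRel G ((β ^ k * (a ^ k)⁻¹) y) y := by
    have := TriangleRel.pow_apply (hPG hβP) hβ k ((a ^ k)⁻¹ y)
    rwa [perm_apply_inv_self] at this
  choose d hdG hd1 hd2 using fun k => exists_mem_eq_on_class hP (hfP k) (hfr k) ((a ^ k) x₀)
  have huniq {k l : ℕ} (hk : k < 5) (hl : l < 5) (hlk : l ≠ k) {y : X}
      (hy : TriangleRel G ((a ^ k) x₀) y) : ¬ TriangleRel G ((a ^ l) x₀) y := by
    intro h
    have := ht ((a ^ k) x₀) ((l : ℤ) - k) (by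
      have h' := hy.trans h.symm
      rw [← zpow_natCast, ← zpow_natCast] at h'
      rwa [← zpow_natCast, ← mul_apply, ← zpow_add, sub_add_cancel])
    omega
  set δ := d 0 * d 1 * d 2 * d 3 * d 4 with hδ
  have hδG : δ ∈ G :=
    mul_mem (mul_mem (mul_mem (mul_mem (hdG 0) (hdG 1)) (hdG 2)) (hdG 3)) (hdG 4)
  have hδk {k : ℕ} (hk : k < 5) {y : X} (hy : TriangleRel G ((a ^ k) x₀) y) :
      δ y = (β ^ k * (a ^ k)⁻¹) y := by
    have h1 {l : ℕ} (hl : l < 5) (hlk : l ≠ k) : d l y = y := hd2 l y (huniq hk hl hlk hy)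
    have h2 {l : ℕ} (hl : l < 5) (hlk : l ≠ k) :
        d l ((β ^ k * (a ^ k)⁻¹) y) = (β ^ k * (a ^ k)⁻¹) y :=
      hd2 l _ (huniq hk hl hlk (hy.trans (hfr k y).symm))
    have h3 := hd1 k y hy
    generalize (β ^ k * (a ^ k)⁻¹) y = z at *
    simp only [hδ, mul_apply]
    interval_cases k
    · rw [h1, h1, h1, h1, h3] <;> norm_num
    · rw [h1, h1, h1, h3, h2] <;> norm_num
    · rw [h1, h1, h3, h2, h2] <;> norm_num
    · rw [h1, h3, h2, h2, h2] <;> norm_num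
    · rw [h3, h2, h2, h2, h2] <;> norm_num
  refine ⟨δ, hδG, sameCycle_map_iff_of_apply ha.pow_five hb.pow_five ha.apply_ne hb.apply_ne
    fun s => ?_⟩
  obtain ⟨t', ht', hs⟩ := hm s x₀
  obtain ⟨k, hk, rfl⟩ := (sameCycle_iff_exists_pow_of_pow_five ha.pow_five).mp ht'
  have hstep : δ (a s) = (β ^ (k + 1) * (a ^ (k + 1))⁻¹) (a s) := by
    have has : TriangleRel G ((a ^ (k + 1)) x₀) (a s) := by
      rw [pow_succ']
      exact hs.symm.map ha.mem
    by_cases hk4 : k + 1 < 5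
    · exact hδk hk4 has
    · have hk5 : k + 1 = 5 := by omega
      rw [hk5, ha.pow_five] at has
      rw [hδk (k := 0) (by norm_num) (by simpa using has), hk5, ha.pow_five, hβ5]
      simp
  have : δ (a s) = β (δ s) := by
    rw [hstep, hδk hk hs.symm]
    rw [pow_succ' β, pow_succ' a, mul_inv_rev]
    simp only [mul_apply]
    rw [perm_inv_apply_self]
  rw [this]
  exact hβb _

theorem exists_sameCycle_map_iff [Fintype X] (hX : Fintype.card X = 40) (hPG : P ≤ G)
    (hP : IsPGroup 5 P) (ha : IsCentrallyTransitive G a) (hb : IsCentrallyTransitive G b)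
    (haP : a ∈ P) (hbP : b ∈ P) :
    ∃ δ ∈ G, ∀ s t, a.SameCycle s t ↔ b.SameCycle (δ s) (δ t) := by
  classical
  have key {a b : Perm X} (ha : IsCentrallyTransitive G a) (hb : IsCentrallyTransitive G b)
      (haP : a ∈ P) (hbP : b ∈ P) (hm : TriangleClassesMeet G a) :
      ∃ δ ∈ G, ∀ s t, a.SameCycle s t ↔ b.SameCycle (δ s) (δ t) := by
    by_cases ht : ∀ x, ∀ j : ℤ, TriangleRel G x ((a ^ j) x) → (5 : ℤ) ∣ j
    · exact exists_sameCycle_map_iff_of_transversal hX hPG hP ha hb haP hbP hm ht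
    · push Not at ht
      obtain ⟨x, j, hx, hj⟩ := ht
      exact exists_sameCycle_map_iff_of_alternatingGroup_le hX
        (alternatingGroup_le_of_triangleRel_zpow ha hm hj hx) ha.pow_five hb.pow_five
        ha.apply_ne hb.apply_ne
  rcases preservesCycles_or_triangleClassesMeet hX hPG hP ha haP with h1 | h1
  swap
  · exact key ha hb haP hbP h1
  rcases preservesCycles_or_triangleClassesMeet hX hPG hP hb hbP with h2 | h2
  swap
  · obtain ⟨δ, hδ, h⟩ := key hb ha hbP haP h2
    refine ⟨δ⁻¹, inv_mem hδ, fun s t => ?_⟩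
    rw [h, perm_apply_inv_self, perm_apply_inv_self]
  have hab := h1 b hbP
  by_cases hall : ∀ t, a.SameCycle t (b t)
  · exact ⟨1, one_mem G, sameCycle_iff_of_forall hab ha.pow_five hb.pow_five ha.apply_ne
      hb.apply_ne hall⟩
  · push Not at hall
    obtain ⟨p, hp⟩ := hall
    exact key ha hb haP hbP (triangleClassesMeet_of_commute hX ha hb
      (hab.commute hP haP hbP ha.pow_five hb.pow_five ha.apply_ne (h2 a haP)) hp)

end Transversal

section BlockSystem

theorem isCompleteBlockSystem_orbitFive {X : Type*} [Fintype X] [DecidableEq X] {a : Perm X}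
    (ha5 : a ^ 5 = 1) {K : Subgroup (Perm X)} (hK : K ≤ cycleStabilizer a) :
    IsCompleteBlockSystem K (Finset.univ.image (orbitFive a)) := by
  constructor
  · intro x
    refine ⟨orbitFive a x, ⟨Finset.mem_image_of_mem _ (Finset.mem_univ x),
      (mem_orbitFive ha5).mpr (SameCycle.refl _ _)⟩, ?_⟩
    rintro B ⟨hB, hx⟩
    obtain ⟨y, -, rfl⟩ := Finset.mem_image.mp hB
    rw [mem_orbitFive ha5] at hx
    ext z
    rw [mem_orbitFive ha5, mem_orbitFive ha5]
    exact ⟨hx.symm.trans, hx.trans⟩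
  · intro B hB g hg
    obtain ⟨y, -, rfl⟩ := Finset.mem_image.mp hB
    refine Finset.mem_image.mpr ⟨g y, Finset.mem_univ _, ?_⟩
    ext z
    obtain ⟨z, rfl⟩ := g.surjective z
    rw [mem_orbitFive ha5, Function.Injective.mem_finset_image g.injective, mem_orbitFive ha5,
      hK hg]

theorem isCentrallyTransitive_toPerm {H : Type*} [CommGroup H] {G : Subgroup (Perm H)}
    (hG : leftRegular H ≤ G) {h : H} (h5 : h ^ 5 = 1) (h1 : h ≠ 1) :
    IsCentrallyTransitive G (MulAction.toPermHom H H h) where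
  mem := hG ⟨h, rfl⟩
  pow_five := by rw [← map_pow, h5, map_one]
  apply_ne x := fun hx => h1 (by simpa using hx)
  exists_commute x y := ⟨MulAction.toPermHom H H (y * x⁻¹), hG ⟨_, rfl⟩,
    (Commute.all _ _).map _, by simp⟩

theorem isCentrallyTransitive_conj_toPerm {H : Type*} [CommGroup H] {G : Subgroup (Perm H)}
    {φ : Perm H} (hG : conjBy φ (leftRegular H) ≤ G) {h : H} (h5 : h ^ 5 = 1) (h1 : h ≠ 1) :
    IsCentrallyTransitive G (MulAut.conj φ⁻¹ (MulAction.toPermHom H H h)) where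
  mem := hG ⟨_, ⟨h, rfl⟩, rfl⟩
  pow_five := by rw [← map_pow, ← map_pow, h5, map_one, map_one]
  apply_ne x := fun hx => h1 (by
    have := congrArg φ hx
    simpa using this)
  exists_commute x y := ⟨MulAut.conj φ⁻¹ (MulAction.toPermHom H H (φ y * (φ x)⁻¹)),
    hG ⟨_, ⟨_, rfl⟩, rfl⟩, ((Commute.all _ _).map _).map _, by simp⟩

theorem exists_conj_mem_isPGroup {p : ℕ} [Fact p.Prime] {M : Type*} [Group M] [Finite M]
    {G : Subgroup M} {a b : M} (ha : a ∈ G) (hb : b ∈ G) (hap : a ^ p = 1) (hbp : b ^ p = 1) :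
    ∃ P ≤ G, IsPGroup p P ∧ a ∈ P ∧ ∃ g ∈ G, g * b * g⁻¹ ∈ P := by
  have hz {c : M} (hc : c ∈ G) (hcp : c ^ p = 1) :
      ∃ Q : Sylow p G, (⟨c, hc⟩ : G) ∈ Q := by
    have : IsPGroup p (Subgroup.zpowers (⟨c, hc⟩ : G)) := by
      rintro ⟨_, n, rfl⟩
      refine ⟨1, Subtype.ext (Subtype.ext ?_)⟩
      change (c ^ n) ^ p ^ 1 = 1
      rw [pow_one, ← zpow_natCast, ← zpow_mul, mul_comm, zpow_mul, zpow_natCast, hcp, one_zpow]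
    obtain ⟨Q, hQ⟩ := this.exists_le_sylow
    exact ⟨Q, hQ (Subgroup.mem_zpowers _)⟩
  obtain ⟨Q, hQ⟩ := hz ha hap
  obtain ⟨R, hR⟩ := hz hb hbp
  obtain ⟨g, rfl⟩ := MulAction.exists_smul_eq G R Q
  refine ⟨((g • R : Sylow p G) : Subgroup G).map G.subtype, Subgroup.map_subtype_le _,
    (g • R).isPGroup'.map _, ⟨_, hQ, rfl⟩, g, g.2, ⟨g * ⟨b, hb⟩ * g⁻¹, ?_, rfl⟩⟩
  exact Subgroup.smul_mem_pointwise_smul _ (MulAut.conj g) _ hR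

end BlockSystem

end

theorem statement_11 (φ : Equiv.Perm Hgrp) :
    ∃ δ ∈ leftRegular Hgrp ⊔ conjBy φ (leftRegular Hgrp),
      ∃ ℬ : Finset (Finset Hgrp),
        IsCompleteBlockSystem (leftRegular Hgrp ⊔ conjBy (φ * δ) (leftRegular Hgrp)) ℬ ∧
        ∀ B ∈ ℬ, B.card = 5 := by
  have hX : Fintype.card Hgrp = 40 := by
    simp [Hgrp, Fintype.card_multiplicative, ZMod.card]
  set G := leftRegular Hgrp ⊔ conjBy φ (leftRegular Hgrp) with hG
  obtain ⟨h, h5, h1⟩ : ∃ h : Hgrp, h ^ 5 = 1 ∧ h ≠ 1 :=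
    ⟨Multiplicative.ofAdd ((0, 0, 0), 1), by decide, by decide⟩
  have ha : IsCentrallyTransitive G (MulAction.toPermHom Hgrp Hgrp h) :=
    isCentrallyTransitive_toPerm le_sup_left h5 h1
  have hb : IsCentrallyTransitive G (MulAut.conj φ⁻¹ (MulAction.toPermHom Hgrp Hgrp h)) :=
    isCentrallyTransitive_conj_toPerm le_sup_right h5 h1
  have : Fact (Nat.Prime 5) := ⟨by norm_num⟩
  obtain ⟨P, hPG, hP, haP, g, hg, hbP⟩ :=
    exists_conj_mem_isPGroup ha.mem hb.mem ha.pow_five hb.pow_five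
  obtain ⟨δ, hδ, hiff⟩ := exists_sameCycle_map_iff hX hPG hP ha (hb.conj hg) haP hbP
  have hcyc (s t : Hgrp) : (MulAction.toPermHom Hgrp Hgrp h).SameCycle s t ↔
      (MulAut.conj (φ * (g⁻¹ * δ))⁻¹ (MulAction.toPermHom Hgrp Hgrp h)).SameCycle s t := by
    rw [hiff, MulAut.conj_apply, MulAut.conj_apply, Equiv.Perm.sameCycle_conj,
      Equiv.Perm.sameCycle_conj, Equiv.Perm.sameCycle_conj, inv_inv, inv_inv]
    rfl
  refine ⟨g⁻¹ * δ, mul_mem (inv_mem hg) hδ,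
    Finset.univ.image (orbitFive (MulAction.toPermHom Hgrp Hgrp h)),
    isCompleteBlockSystem_orbitFive ha.pow_five (sup_le ?_ ?_), fun B hB => ?_⟩
  · rintro _ ⟨k, rfl⟩
    exact mem_cycleStabilizer_of_commute ((Commute.all k h).map _)
  · rintro _ ⟨_, ⟨k, rfl⟩, rfl⟩ x y
    rw [hcyc, hcyc]
    refine mem_cycleStabilizer_of_commute
      (((Commute.all k h).map (MulAction.toPermHom Hgrp Hgrp)).map (MulAut.conj _)) x y
  · obtain ⟨x, -, rfl⟩ := Finset.mem_image.mp hB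
    exact card_orbitFive ha.pow_five ha.apply_ne x
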